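/- Let V be a Banach 𝕆-bimodule, T a power-associative bounded right para-linear operator on V, and s ∈ 𝕆 with |s| > ‖T‖. Then R_s − T is invertible among bounded real-linear operators on V, and its regular inverses are given by the norm-convergent series (R_s − T)^{⊚−} = ∑_{n≥0} Tⁿ ⊙ s^{−1−n} and (R_s − T)^{−⊚} = ∑_{n≥0} s^{−1−n} ⊙ Tⁿ. -/

import Mathlib

noncomputable section

open scoped BigOperators

/-- Octonions, realized via the Cayley–Dickson doubling of the quaternions. -/
@[ext]
structure Oct : Type where
  a : Quaternion ℝ
  b : Quaternion ℝ

namespace Oct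

instance : Zero Oct := ⟨⟨0, 0⟩⟩
instance : Add Oct := ⟨fun x y => ⟨x.a + y.a, x.b + y.b⟩⟩
instance : Neg Oct := ⟨fun x => ⟨-x.a, -x.b⟩⟩
instance : Sub Oct := ⟨fun x y => ⟨x.a - y.a, x.b - y.b⟩⟩
instance : SMul ℕ Oct := ⟨fun n x => ⟨n • x.a, n • x.b⟩⟩
instance : SMul ℤ Oct := ⟨fun n x => ⟨n • x.a, n • x.b⟩⟩
instance : SMul ℝ Oct := ⟨fun r x => ⟨r • x.a, r • x.b⟩⟩

def toLp (x : Oct) : WithLp 2 (Quaternion ℝ × Quaternion ℝ) :=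
  (WithLp.equiv 2 (Quaternion ℝ × Quaternion ℝ)).symm (x.a, x.b)

lemma toLp_injective : Function.Injective toLp := by
  rintro ⟨xa, xb⟩ ⟨ya, yb⟩ h
  have ha : xa = ya :=
    congrArg (fun z => (WithLp.equiv 2 (Quaternion ℝ × Quaternion ℝ) z).1) h
  have hb : xb = yb :=
    congrArg (fun z => (WithLp.equiv 2 (Quaternion ℝ × Quaternion ℝ) z).2) h
  subst ha; subst hb; rfl

instance : AddCommGroup Oct :=
  toLp_injective.addCommGroup toLp rfl (fun _ _ => rfl) (fun _ => rfl) (fun _ _ => rfl)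
    (fun _ _ => rfl) (fun _ _ => rfl)

def toLpHom : Oct →+ WithLp 2 (Quaternion ℝ × Quaternion ℝ) where
  toFun := toLp
  map_zero' := rfl
  map_add' _ _ := rfl

instance : Module ℝ Oct := toLp_injective.module ℝ toLpHom fun _ _ => rfl

instance : NormedAddCommGroup Oct :=
  NormedAddCommGroup.induced Oct (WithLp 2 (Quaternion ℝ × Quaternion ℝ)) toLpHom toLp_injective

instance : NormedSpace ℝ Oct := ⟨fun r x => norm_smul_le r (toLp x)⟩

def toProdLin : Oct →ₗ[ℝ] Quaternion ℝ × Quaternion ℝ where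
  toFun x := (x.a, x.b)
  map_add' _ _ := rfl
  map_smul' _ _ := rfl

lemma toProdLin_injective : Function.Injective toProdLin := by
  rintro ⟨xa, xb⟩ ⟨ya, yb⟩ h
  have ha : xa = ya := congrArg Prod.fst h
  have hb : xb = yb := congrArg Prod.snd h
  subst ha; subst hb; rfl

instance : FiniteDimensional ℝ Oct :=
  FiniteDimensional.of_injective toProdLin toProdLin_injective

instance : CompleteSpace Oct := FiniteDimensional.complete ℝ Oct

instance : One Oct := ⟨⟨1, 0⟩⟩

instance : Mul Oct :=
  ⟨fun x y => ⟨x.a * y.a - star y.b * x.b, y.b * x.a + x.b * star y.a⟩⟩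

/-- Octonionic conjugation. -/
def conj (x : Oct) : Oct := ⟨star x.a, -x.b⟩

/-- The real part of an octonion. -/
def re (x : Oct) : ℝ := x.a.re

/-- Powers of an octonion (association chosen on the left factor). -/
def opow (s : Oct) : ℕ → Oct
  | 0 => 1
  | n + 1 => s * opow s n

/-- The inverse of a nonzero octonion. -/
def oinv (s : Oct) : Oct := (‖s‖ ^ 2)⁻¹ • conj s

/-- `invPow s n` is the octonion `s ^ (-1 - n)`. -/
def invPow (s : Oct) (n : ℕ) : Oct := opow (oinv s) (n + 1)

def eNat : ℕ → Oct
  | 0 => ⟨1, 0⟩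
  | 1 => ⟨⟨0, 1, 0, 0⟩, 0⟩
  | 2 => ⟨⟨0, 0, 1, 0⟩, 0⟩
  | 3 => ⟨⟨0, 0, 0, 1⟩, 0⟩
  | 4 => ⟨0, 1⟩
  | 5 => ⟨0, ⟨0, 1, 0, 0⟩⟩
  | 6 => ⟨0, ⟨0, 0, 1, 0⟩⟩
  | 7 => ⟨0, ⟨0, 0, 0, 1⟩⟩
  | _ => 0

/-- The standard basis `e_0 = 1, e_1, …, e_7` of the octonions. -/
def e (i : Fin 8) : Oct := eNat i.val

/-- The six-dimensional sphere `𝕊` of imaginary units of `𝕆`. -/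
def unitSphere : Set Oct := {J | J * J = -1}

/-- The slice `ℂ_J = ℝ ⊕ ℝJ` of the octonions. -/
def sliceC (J : Oct) : Set Oct := {s | ∃ x y : ℝ, s = x • (1 : Oct) + y • J}

/-- The embedding of `ℂ` onto the slice `ℂ_J`, `x + y i ↦ x + y J`. -/
def toSlice (J : Oct) (z : ℂ) : Oct := z.re • (1 : Oct) + z.im • J

end Oct

open Oct

/-- A (normed/Banach) `𝕆`-bimodule: a real normed space with continuous real-bilinear left and
right octonionic multiplications satisfying the alternativity relations
`[p,q,x] = [q,x,p] = [x,p,q] = -[q,p,x]` and the norm identities `‖px‖ = |p|‖x‖ = ‖xp‖`. -/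
class OctBimodule (V : Type*) [NormedAddCommGroup V] [NormedSpace ℝ V] : Type _ where
  lm : Oct →ₗ[ℝ] V →L[ℝ] V
  rm : Oct →ₗ[ℝ] V →L[ℝ] V
  lm_one : ∀ x : V, lm 1 x = x
  rm_one : ∀ x : V, rm 1 x = x
  /-- `[p,q,x] = [q,x,p]` -/
  assoc_cyc₁ : ∀ (p q : Oct) (x : V),
    lm (p * q) x - lm p (lm q x) = rm p (lm q x) - lm q (rm p x)
  /-- `[p,q,x] = [x,p,q]` -/
  assoc_cyc₂ : ∀ (p q : Oct) (x : V),
    lm (p * q) x - lm p (lm q x) = rm q (rm p x) - rm (p * q) x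
  /-- `[p,q,x] = -[q,p,x]` -/
  assoc_alt : ∀ (p q : Oct) (x : V),
    lm (p * q) x - lm p (lm q x) = -(lm (q * p) x - lm q (lm p x))
  norm_lm : ∀ (p : Oct) (x : V), ‖lm p x‖ = ‖p‖ * ‖x‖
  norm_rm : ∀ (p : Oct) (x : V), ‖rm p x‖ = ‖p‖ * ‖x‖

section OctMod

variable {V : Type*} [NormedAddCommGroup V] [NormedSpace ℝ V] [OctBimodule V]

/-- Left multiplication `x ↦ p x` as a bounded real-linear operator. -/
def lmo (p : Oct) : V →L[ℝ] V := OctBimodule.lm p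

/-- Right multiplication `R_p : x ↦ x p` as a bounded real-linear operator. -/
def rmo (p : Oct) : V →L[ℝ] V := OctBimodule.rm p

variable (V)

/-- The real-part projection `Re x = (5/12) x - (1/12) ∑_{i=1}^7 e_i x e_i` of an
`𝕆`-bimodule. -/
def reO : V →L[ℝ] V :=
  (5 / 12 : ℝ) • ContinuousLinearMap.id ℝ V -
    (1 / 12 : ℝ) • ∑ i : Fin 7, (rmo (e i.succ)).comp (lmo (e i.succ))

/-- The real part `Re V` of an `𝕆`-bimodule, i.e. the set of associative central elements. -/
def ReSet : Set V :=
  {m | (∀ p q : Oct, lmo (p * q) m = lmo p (lmo q m)) ∧ ∀ p : Oct, lmo p m = rmo p m}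

/-- The slice `ℂ_J(V) = Re V ⊕ J · Re V` of an `𝕆`-bimodule. -/
def CJV (J : Oct) : Set V :=
  {x | ∃ u ∈ ReSet V, ∃ w ∈ ReSet V, x = u + lmo J w}

/-- The slice projection `π_J(x) = Re x + J Re (J̄ x)`. -/
def piJ (J : Oct) : V →L[ℝ] V :=
  reO V + (lmo J).comp ((reO V).comp (lmo (Oct.conj J)))

variable {V}

/-- The second right associator `B_p(T, x) = T(x) p - T(x p)` of an operator. -/
def Bop (p : Oct) (T : V →L[ℝ] V) : V →L[ℝ] V := (rmo p).comp T - T.comp (rmo p)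

/-- A bounded real-linear operator is right (octonionic) para-linear if `Re B_p(T,x) = 0`. -/
def IsRightPara (T : V →L[ℝ] V) : Prop := ∀ (p : Oct) (x : V), reO V (Bop p T x) = 0

/-- The left octonionic scalar multiplication `(p ⊙ T)(x) = p T(x) + B_p(T,x)` on operators. -/
def odotL (p : Oct) (T : V →L[ℝ] V) : V →L[ℝ] V := (lmo p).comp T + Bop p T

/-- The right octonionic scalar multiplication `(T ⊙ p)(x) = T(p x) - B_p(T,x)` on operators. -/
def odotR (T : V →L[ℝ] V) (p : Oct) : V →L[ℝ] V := T.comp (lmo p) - Bop p T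

/-- The lifting map, `(lif F)(x) = ∑_i F(x ē_i) e_i`. -/
def lifO (F : V →L[ℝ] V) : V →L[ℝ] V :=
  ∑ i : Fin 8, (rmo (e i)).comp (F.comp (rmo (Oct.conj (e i))))

/-- The extension map, `(ext G)(∑ x_i e_i) = ∑ G(x_i) e_i`, where `x_i = Re (x ē_i)`. -/
def extO (G : V →L[ℝ] V) : V →L[ℝ] V :=
  ∑ i : Fin 8, (rmo (e i)).comp (G.comp ((reO V).comp (rmo (Oct.conj (e i)))))

/-- The left regular power `T^{n⊚} = lif (Re ∘ Tⁿ)`. -/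
def rpowL (T : V →L[ℝ] V) (n : ℕ) : V →L[ℝ] V := lifO ((reO V).comp (T ^ n))

/-- The right regular power `T^{⊚n} = ext (Tⁿ|_{Re V})`. -/
def rpowR (T : V →L[ℝ] V) (n : ℕ) : V →L[ℝ] V := extO (T ^ n)

/-- The regular composition `f ⊚ g = lif (Re ∘ f ∘ g)`. -/
def rcomp (f g : V →L[ℝ] V) : V →L[ℝ] V := lifO ((reO V).comp (f.comp g))

/-- The composition associator `[f,g,x]_⊚ = (f ⊚ g)(x) - f(g(x))`. -/
def compAssoc (f g : V →L[ℝ] V) (x : V) : V := rcomp f g x - f (g x)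

/-- The right regular inverse `T^{⊚-} = ext (T⁻¹|_{Re V})` of an invertible operator. -/
def rinvR (T : V →L[ℝ] V) : V →L[ℝ] V := extO (Ring.inverse T)

/-- The left regular inverse `T^{-⊚} = lif (Re ∘ T⁻¹)` of an invertible operator. -/
def rinvL (T : V →L[ℝ] V) : V →L[ℝ] V := lifO ((reO V).comp (Ring.inverse T))

/-- An operator is power-associative if all of its (composition) powers are right
para-linear. -/
def IsPowerAssoc (T : V →L[ℝ] V) : Prop := ∀ n : ℕ, IsRightPara (T ^ n)

/-- A bounded operator is octonionic linear if `T(xp) = T(x)p` for all `p`. -/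
def IsOctLinear (T : V →L[ℝ] V) : Prop := ∀ (p : Oct) (x : V), T (rmo p x) = rmo p (T x)

/-- `S` is `ℂ_J`-extendable power associative: `Sⁿ(v s) = Sⁿ(v) s` for `v ∈ Re V`,
`s ∈ ℂ_J`, `n ≥ 1`. -/
def CJExtPA (J : Oct) (S : V →L[ℝ] V) : Prop :=
  ∀ n : ℕ, 1 ≤ n → ∀ v ∈ ReSet V, ∀ s ∈ sliceC J, (S ^ n) (rmo s v) = rmo s ((S ^ n) v)

/-- `S` is `ℂ_J`-liftable power associative: `Re (Sⁿ(v s)) = Re (Sⁿ(v) s)` for all `v ∈ V`,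
`s ∈ ℂ_J`, `n ≥ 1`. -/
def CJLiftPA (J : Oct) (S : V →L[ℝ] V) : Prop :=
  ∀ n : ℕ, 1 ≤ n → ∀ (v : V), ∀ s ∈ sliceC J,
    reO V ((S ^ n) (rmo s v)) = reO V (rmo s ((S ^ n) v))

/-- The pull-back slice-resolvent set `ρ*_J(T)`. -/
def pbResSlice (T : V →L[ℝ] V) (J : Oct) : Set Oct :=
  {s | s ∈ sliceC J ∧ IsUnit ((rmo s : V →L[ℝ] V) - T) ∧
    CJExtPA J (Ring.inverse ((rmo s : V →L[ℝ] V) - T))}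

/-- The pull-back resolvent set `ρ*(T)`. -/
def pbRes (T : V →L[ℝ] V) : Set Oct := ⋃ J ∈ unitSphere, pbResSlice T J

/-- The pull-back spectrum `σ*(T) = 𝕆 ∖ ρ*(T)`. -/
def pbSpec (T : V →L[ℝ] V) : Set Oct := Set.univ \ pbRes T

/-- The push-forward slice-resolvent set `ρ_{*J}(T)`. -/
def pfResSlice (T : V →L[ℝ] V) (J : Oct) : Set Oct :=
  {s | s ∈ sliceC J ∧ IsUnit ((rmo s : V →L[ℝ] V) - T) ∧
    CJLiftPA J (Ring.inverse ((rmo s : V →L[ℝ] V) - T))}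

/-- The push-forward resolvent set `ρ_*(T)`. -/
def pfRes (T : V →L[ℝ] V) : Set Oct := ⋃ J ∈ unitSphere, pfResSlice T J

/-- The push-forward spectrum `σ_*(T) = 𝕆 ∖ ρ_*(T)`. -/
def pfSpec (T : V →L[ℝ] V) : Set Oct := Set.univ \ pfRes T

/-- The real-part projection of the `𝕆`-bimodule `𝓑_RO(V)` of bounded right para-linear
operators, given by `Re A = (5/12) A - (1/12) ∑_{i=1}^7 (e_i ⊙ A) ⊙ e_i`. -/
def reOpB (A : V →L[ℝ] V) : V →L[ℝ] V :=
  (5 / 12 : ℝ) • A - (1 / 12 : ℝ) • ∑ i : Fin 7, odotR (odotL (e i.succ) A) (e i.succ)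

end OctMod

/-- A set `U ⊆ 𝕆` is slice-open if `U ∩ ℂ_J` is open in `ℂ_J` for every `J ∈ 𝕊`. -/
def SliceOpen (U : Set Oct) : Prop :=
  ∀ J ∈ unitSphere, IsOpen (Oct.toSlice J ⁻¹' U)

/-- A parametrization of the boundary `∂(U ∩ ℂ_J)` by finitely many continuously
differentiable, positively oriented Jordan curves (positivity of the orientation is encoded
through the winding numbers). -/
structure SliceContour (J : Oct) (U : Set Oct) where
  n : ℕ
  γ : Fin n → ℝ → ℂ
  smooth : ∀ i, ContDiff ℝ 1 (γ i)
  closed : ∀ i, γ i 0 = γ i 1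
  jordan : ∀ i, Set.InjOn (γ i) (Set.Ico (0 : ℝ) 1)
  image_eq : (⋃ i, γ i '' Set.Icc (0 : ℝ) 1) = frontier (Oct.toSlice J ⁻¹' U)
  winding_inside : ∀ z : ℂ, Oct.toSlice J z ∈ U →
    (∑ i, ∫ t in (0 : ℝ)..1, deriv (γ i) t / (γ i t - z)) = 2 * (Real.pi : ℂ) * Complex.I
  winding_outside : ∀ z : ℂ, Oct.toSlice J z ∉ closure U →
    (∑ i, ∫ t in (0 : ℝ)..1, deriv (γ i) t / (γ i t - z)) = 0

/-- The integral `∫_{∂(U ∩ ℂ_J)} Φ(s, ds)` along a slice contour: the integrand gets the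
point of the curve and its derivative (both in the coordinates of the slice). -/
def contourSum {J : Oct} {U : Set Oct} (Γ : SliceContour J U) {E : Type*}
    [NormedAddCommGroup E] [NormedSpace ℝ E] (Φ : ℂ → ℂ → E) : E :=
  ∑ i, ∫ t in (0 : ℝ)..1, Φ (Γ.γ i t) (deriv (Γ.γ i) t)

/-- An axially symmetric slice domain (s-domain) in `𝕆`. -/
structure IsAdmissibleDomain (U : Set Oct) : Prop where
  isOpen : IsOpen U
  isConnected : IsConnected U
  real_nonempty : (U ∩ {s : Oct | ∃ r : ℝ, s = r • (1 : Oct)}).Nonempty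
  axially : ∀ (z : ℂ), ∀ I ∈ unitSphere, ∀ J ∈ unitSphere,
    Oct.toSlice I z ∈ U → Oct.toSlice J z ∈ U
  slice_conn : ∀ J ∈ unitSphere, IsConnected (Oct.toSlice J ⁻¹' U)

section Adm

variable {V : Type*} [NormedAddCommGroup V] [NormedSpace ℝ V] [OctBimodule V]

/-- A `T`-left-admissible domain: an axially symmetric s-domain containing the pull-back
spectrum `σ*(T)`.  (The regularity of its slice boundaries is witnessed by the slice
contours used in the integrals.) -/
def LeftAdmissible (T : V →L[ℝ] V) (U : Set Oct) : Prop :=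
  IsAdmissibleDomain U ∧ pbSpec T ⊆ U

/-- A `T`-right-admissible domain: an axially symmetric s-domain containing the push-forward
spectrum `σ_*(T)`. -/
def RightAdmissible (T : V →L[ℝ] V) (U : Set Oct) : Prop :=
  IsAdmissibleDomain U ∧ pfSpec T ⊆ U

end Adm

/-- The axially symmetric set `Ω_D ⊆ 𝕆` induced by a conjugation-invariant set `D ⊆ ℂ`. -/
def OmegaD (D : Set ℂ) : Set Oct := ⋃ J ∈ unitSphere, Oct.toSlice J '' D

/-- `F` is the stem of a slice preserving slice regular function on `Ω_D`: it is holomorphic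
on the open conjugation-invariant set `D` and intertwines complex conjugation. -/
structure IsStem (D : Set ℂ) (F : ℂ → ℂ) : Prop where
  isOpen : IsOpen D
  conj_mem : ∀ z ∈ D, (starRingEnd ℂ) z ∈ D
  holo : DifferentiableOn ℂ F D
  conj_comm : ∀ z ∈ D, F ((starRingEnd ℂ) z) = (starRingEnd ℂ) (F z)

section FC

variable {V : Type*} [NormedAddCommGroup V] [NormedSpace ℝ V] [OctBimodule V]

/-- The slice integral `(1/2π) ∫_{∂(U∩ℂ_J)} (R_s - T)^{⊚-} ⊙ (ds_J f(s))` defining the left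
slice regular functional calculus of a slice preserving function with stem `F`. -/
def leftFC (T : V →L[ℝ] V) (J : Oct) {U : Set Oct} (Γ : SliceContour J U)
    (F : ℂ → ℂ) : V →L[ℝ] V :=
  (2 * Real.pi)⁻¹ • contourSum Γ fun z dz =>
    odotR (rinvR ((rmo (Oct.toSlice J z) : V →L[ℝ] V) - T))
      ((-(Oct.toSlice J dz) * J) * Oct.toSlice J (F z))

/-- The slice integral `(1/2π) ∫_{∂(U∩ℂ_J)} (f(s) ds_J) ⊙ (R_s - T)^{-⊚}` defining the right
slice regular functional calculus of a slice preserving function with stem `F`. -/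
def rightFC (T : V →L[ℝ] V) (J : Oct) {U : Set Oct} (Γ : SliceContour J U)
    (F : ℂ → ℂ) : V →L[ℝ] V :=
  (2 * Real.pi)⁻¹ • contourSum Γ fun z dz =>
    odotL (Oct.toSlice J (F z) * (-(Oct.toSlice J dz) * J))
      (rinvL ((rmo (Oct.toSlice J z) : V →L[ℝ] V) - T))

end FC

/-- The family of stems of the components, relative to `J = ∑ c_i e_i`, of a function of the
form `f₀ + f₁ • J` with `f₀, f₁` slice preserving with stems `F₀, F₁`. -/
def stemFamily (c : Fin 8 → ℝ) (F₀ F₁ : ℂ → ℂ) : Fin 8 → ℂ → ℂ :=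
  fun i z => if i = 0 then F₀ z else (c i : ℂ) * F₁ z

namespace Oct

/-- Left multiplication by an octonion, as a real-linear map. -/
def lmulLin (q : Oct) : Oct →ₗ[ℝ] Oct where
  toFun x := q * x
  map_add' x y := by
    refine Oct.ext ?_ ?_
    · show q.a * (x.a + y.a) - star (x.b + y.b) * q.b =
        (q.a * x.a - star x.b * q.b) + (q.a * y.a - star y.b * q.b)
      rw [mul_add, star_add, add_mul]; abel
    · show (x.b + y.b) * q.a + q.b * star (x.a + y.a) =
        (x.b * q.a + q.b * star x.a) + (y.b * q.a + q.b * star y.a)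
      rw [add_mul, star_add, mul_add]; abel
  map_smul' r x := by
    refine Oct.ext ?_ ?_
    · show q.a * (r • x.a) - star (r • x.b) * q.b = r • (q.a * x.a - star x.b * q.b)
      rw [mul_smul_comm, Quaternion.star_smul, smul_mul_assoc, smul_sub]
    · show (r • x.b) * q.a + q.b * star (r • x.a) = r • (x.b * q.a + q.b * star x.a)
      rw [smul_mul_assoc, Quaternion.star_smul, mul_smul_comm, smul_add]

/-- Left multiplication `L_q : x ↦ q x` as a bounded real-linear operator on `𝕆`. -/
def Lq (q : Oct) : Oct →L[ℝ] Oct := (lmulLin q).toContinuousLinearMap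

/-- The two-sphere `[q] = {Re q + |Im q| J : J ∈ 𝕊}` associated with an octonion `q`. -/
def qSphere (q : Oct) : Set Oct :=
  {s | ∃ J ∈ unitSphere, s = Oct.re q • (1 : Oct) + ‖q - Oct.re q • (1 : Oct)‖ • J}

end Oct

/-- A nonassociative ring is alternative if its associator vanishes when two neighbouring
arguments coincide. -/
class IsAlternativeRing (A : Type*) [NonUnitalNonAssocRing A] : Prop where
  associator_left_self : ∀ x y : A, associator x x y = 0
  associator_right_self : ∀ x y : A, associator y x x = 0

namespace IsAlternativeRing

variable {A : Type*} [NonUnitalNonAssocRing A] [IsAlternativeRing A]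

theorem associator_swap_left (x y z : A) : associator x y z = -associator y x z := by
  have h := associator_left_self (x + y) z
  have hx := associator_left_self x z
  have hy := associator_left_self y z
  simp only [associator_apply, add_mul, mul_add] at h hx hy ⊢
  linear_combination (norm := abel) h - hx - hy

theorem associator_swap_right (x y z : A) : associator x y z = -associator x z y := by
  have h := associator_right_self (y + z) x
  have hx := associator_right_self y x
  have hy := associator_right_self z x
  simp only [associator_apply, add_mul, mul_add] at h hx hy ⊢
  linear_combination (norm := abel) h - hx - hy

theorem associator_rotate (x y z : A) : associator x y z = associator y z x := by
  rw [associator_swap_left, associator_swap_right, neg_neg]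

theorem associator_swap_outer (x y z : A) : associator x y z = -associator z y x := by
  rw [associator_rotate, associator_swap_left]

theorem associator_mul_middle_left (x y z : A) :
    associator x (x * y) z = associator (x * x) y z - x * associator x y z := by
  have h := associator_cocycle x x y z
  have h₁ := associator_left_self x (y * z)
  have h₂ : associator x x y * z = 0 := by rw [associator_left_self, zero_mul]
  linear_combination (norm := abel) h + h₁ - h₂

theorem associator_mul_middle_right (x y z : A) :
    associator x (y * x) z = associator (x * x) y z - associator x y z * x := by
  have h := associator_cocycle z y x x
  have h₁ := associator_right_self x (z * y)
  have h₂ : z * associator y x x = 0 := by rw [associator_right_self, mul_zero]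
  have h₃ : associator z (y * x) x = -associator x (y * x) z := associator_swap_outer _ _ _
  have h₄ : associator z y (x * x) = -associator (x * x) y z := associator_swap_outer _ _ _
  have h₅ : associator z y x * x = -(associator x y z * x) := by
    rw [associator_swap_outer, neg_mul]
  linear_combination (norm := abel) -h + h₃ - h₄ + h₅ - h₁ + h₂

theorem associator_sq (x y z : A) :
    associator (x * x) y z = x * associator x y z + associator x y z * x := by
  have h := associator_cocycle x y x z
  have h₁ : associator (x * y) x z = -associator x (x * y) z := associator_swap_left _ _ _
  have h₂ : associator x y (x * z) = -associator x (x * z) y := associator_swap_right _ _ _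
  have h₃ : x * associator y x z = -(x * associator x y z) := by
    rw [associator_swap_left, mul_neg]
  have h₄ : associator x y x * z = 0 := by
    rw [associator_swap_right, associator_left_self, neg_zero, zero_mul]
  have h₅ : x * associator x z y = -(x * associator x y z) := by
    rw [associator_swap_right, mul_neg]
  have h₆ : associator (x * x) z y = -associator (x * x) y z := associator_swap_right _ _ _
  have h₇ : associator x y x * z = 0 := h₄
  have m₁ := associator_mul_middle_left x y z
  have m₂ := associator_mul_middle_right x y z
  have m₃ := associator_mul_middle_left x z y
  linear_combination (norm := abel) h - h₃ + h₁ - m₁ - m₂ + h₂ - m₃ - h₆ + h₅ - h₇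

theorem associator_mul_self_middle (x y z : A) :
    associator x (y * x) z = x * associator x y z := by
  rw [associator_mul_middle_right, associator_sq, add_sub_cancel_right]

theorem associator_self_mul_middle (x y z : A) :
    associator x (x * y) z = associator x y z * x := by
  rw [associator_mul_middle_left, associator_sq, add_sub_cancel_left]

theorem middle_moufang (x y z : A) : (x * y) * (z * x) = x * ((y * z) * x) := by
  have h₁ : associator x y (z * x) = x * associator x y z := by
    rw [associator_swap_right, associator_mul_self_middle, associator_swap_right x z y, mul_neg,
      neg_neg]
  have h₂ : x * associator y z x = x * associator x y z := by rw [associator_rotate x y z]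
  simp only [associator_apply, mul_sub] at h₁ h₂
  linear_combination (norm := abel) h₁ - h₂

theorem flexible (x y : A) : (x * y) * x = x * (y * x) := by
  have h := associator_swap_right x y x
  rw [associator_left_self, neg_zero, associator_apply, sub_eq_zero] at h
  exact h

theorem right_moufang (x y z : A) : x * y * z * y = x * (y * z * y) := by
  have h₁ : associator (x * y) z y = -(y * associator x y z) := by
    rw [associator_rotate, associator_rotate, associator_mul_self_middle, associator_swap_left,
      mul_neg]
  have h₂ : associator x y (z * y) = y * associator x y z := by
    rw [associator_rotate, associator_mul_self_middle, associator_rotate x y z, associator_swap_right,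
      associator_rotate]
  rw [flexible]
  simp only [associator_apply, mul_sub] at h₁ h₂
  linear_combination (norm := abel) h₁ + h₂

theorem commutator_mul (x y z : A) :
    x * y * z - z * (x * y) = x * (y * z - z * y) + (x * z - z * x) * y
      + (3 : ℤ) • associator x y z := by
  have h₁ := associator_swap_right x z y
  have h₂ := associator_rotate z x y
  simp only [associator_apply, mul_sub, sub_mul] at h₁ h₂ ⊢
  linear_combination (norm := abel) -h₁ + h₂

/-- For an imaginary unit `p`, an element commuting with `p` associates with `p`. -/
theorem associator_eq_zero_of_commute [IsAddTorsionFree A] {p : A} (hp : ∀ x : A, p * (p * x) = -x)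
    (hpp : ∀ x y : A, associator (p * p) x y = 0) {y : A} (hy : p * y = y * p) (x : A) :
    associator p x y = 0 := by
  have h₁ := associator_mul_self_middle p y x
  have h₂ := associator_self_mul_middle p y x
  have h₃ := associator_sq p y x
  rw [hpp] at h₃
  rw [hy, h₁] at h₂
  rw [← h₂] at h₃
  have h₄ : p * associator p y x = 0 := by
    have : (2 : ℕ) • (p * associator p y x) = 0 := by rw [two_nsmul, ← h₃]
    exact (smul_eq_zero_iff_right two_ne_zero).1 this
  have h₅ : associator p y x = 0 := by
    have h := hp (associator p y x)
    rw [h₄, mul_zero] at h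
    exact neg_eq_zero.1 h.symm
  rw [associator_swap_right, h₅, neg_zero]

/-- The maps `v ↦ p v p` and `v ↦ q v q` commute for orthogonal imaginary units `p` and `q`. -/
theorem sandwich_comm {p q : A} (hl : ∀ x : A, p * (p * x) = -x) (hr : ∀ x : A, x * p * p = -x)
    (hpq : p * q * p = q) (v : A) :
    p * ((q * (v * q)) * p) = q * ((p * (v * p)) * q) := by
  have hU (v : A) : p * ((q * ((p * (v * p)) * q)) * p) = q * (v * q) := by
    have h := middle_moufang p (q * p) (v * p * q)
    rw [middle_moufang q p (v * p), right_moufang, ← flexible p q, hpq] at h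
    exact h.symm
  have h := hU (p * (v * p))
  have e : p * ((p * (v * p)) * p) = v := by
    rw [← flexible, hl]; simp [hr]
  rw [e] at h
  exact h

end IsAlternativeRing

namespace Oct

@[simp] theorem zero_a : (0 : Oct).a = 0 := rfl
@[simp] theorem zero_b : (0 : Oct).b = 0 := rfl
@[simp] theorem one_a : (1 : Oct).a = 1 := rfl
@[simp] theorem one_b : (1 : Oct).b = 0 := rfl
@[simp] theorem add_a (x y : Oct) : (x + y).a = x.a + y.a := rfl
@[simp] theorem add_b (x y : Oct) : (x + y).b = x.b + y.b := rfl
@[simp] theorem neg_a (x : Oct) : (-x).a = -x.a := rfl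
@[simp] theorem neg_b (x : Oct) : (-x).b = -x.b := rfl
@[simp] theorem sub_a (x y : Oct) : (x - y).a = x.a - y.a := rfl
@[simp] theorem sub_b (x y : Oct) : (x - y).b = x.b - y.b := rfl
@[simp] theorem smul_a (r : ℝ) (x : Oct) : (r • x).a = r • x.a := rfl
@[simp] theorem smul_b (r : ℝ) (x : Oct) : (r • x).b = r • x.b := rfl
@[simp] theorem mul_a (x y : Oct) : (x * y).a = x.a * y.a - star y.b * x.b := rfl
@[simp] theorem mul_b (x y : Oct) : (x * y).b = y.b * x.a + x.b * star y.a := rfl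
@[simp] theorem conj_a (x : Oct) : (conj x).a = star x.a := rfl
@[simp] theorem conj_b (x : Oct) : (conj x).b = -x.b := rfl

instance : NonUnitalNonAssocRing Oct :=
  { (inferInstance : AddCommGroup Oct), (inferInstance : Mul Oct) with
    left_distrib := fun x y z => by
      ext1
      · simp only [mul_a, add_a, add_b, star_add, mul_add, add_mul]; abel
      · simp only [mul_b, add_a, add_b, star_add, mul_add, add_mul]; abel
    right_distrib := fun x y z => by
      ext1
      · simp only [mul_a, add_a, add_b, mul_add, add_mul]; abel
      · simp only [mul_b, add_a, add_b, mul_add, add_mul]; abel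
    zero_mul := fun x => by ext1 <;> simp
    mul_zero := fun x => by ext1 <;> simp }

protected theorem one_mul (x : Oct) : 1 * x = x := by ext1 <;> simp

protected theorem mul_one (x : Oct) : x * 1 = x := by ext1 <;> simp

instance : SMulCommClass ℝ Oct Oct :=
  ⟨fun r x y => by ext1 <;> simp [smul_sub]⟩

instance : IsScalarTower ℝ Oct Oct :=
  ⟨fun r x y => by ext1 <;> simp [smul_sub]⟩

/-- The octonion with the given coordinates in the standard basis. -/
def ofCoords (r₀ r₁ r₂ r₃ r₄ r₅ r₆ r₇ : ℝ) : Oct := ⟨⟨r₀, r₁, r₂, r₃⟩, ⟨r₄, r₅, r₆, r₇⟩⟩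

theorem eq_ofCoords (x : Oct) :
    x = ofCoords x.a.re x.a.imI x.a.imJ x.a.imK x.b.re x.b.imI x.b.imJ x.b.imK := rfl

theorem one_eq_ofCoords : (1 : Oct) = ofCoords 1 0 0 0 0 0 0 0 := rfl

theorem mul_eq_ofCoords (x y : Oct) :
    x * y = ofCoords
      (x.a.re * y.a.re - x.a.imI * y.a.imI - x.a.imJ * y.a.imJ - x.a.imK * y.a.imK
        - x.b.re * y.b.re - x.b.imI * y.b.imI - x.b.imJ * y.b.imJ - x.b.imK * y.b.imK)
      (x.a.re * y.a.imI + x.a.imI * y.a.re + x.a.imJ * y.a.imK - x.a.imK * y.a.imJ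
        + x.b.re * y.b.imI - x.b.imI * y.b.re - x.b.imJ * y.b.imK + x.b.imK * y.b.imJ)
      (x.a.re * y.a.imJ - x.a.imI * y.a.imK + x.a.imJ * y.a.re + x.a.imK * y.a.imI
        + x.b.re * y.b.imJ + x.b.imI * y.b.imK - x.b.imJ * y.b.re - x.b.imK * y.b.imI)
      (x.a.re * y.a.imK + x.a.imI * y.a.imJ - x.a.imJ * y.a.imI + x.a.imK * y.a.re
        + x.b.re * y.b.imK - x.b.imI * y.b.imJ + x.b.imJ * y.b.imI - x.b.imK * y.b.re)
      (x.a.re * y.b.re - x.a.imI * y.b.imI - x.a.imJ * y.b.imJ - x.a.imK * y.b.imK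
        + x.b.re * y.a.re + x.b.imI * y.a.imI + x.b.imJ * y.a.imJ + x.b.imK * y.a.imK)
      (x.a.re * y.b.imI + x.a.imI * y.b.re - x.a.imJ * y.b.imK + x.a.imK * y.b.imJ
        - x.b.re * y.a.imI + x.b.imI * y.a.re - x.b.imJ * y.a.imK + x.b.imK * y.a.imJ)
      (x.a.re * y.b.imJ + x.a.imI * y.b.imK + x.a.imJ * y.b.re - x.a.imK * y.b.imI
        - x.b.re * y.a.imJ + x.b.imI * y.a.imK + x.b.imJ * y.a.re - x.b.imK * y.a.imI)
      (x.a.re * y.b.imK - x.a.imI * y.b.imJ + x.a.imJ * y.b.imI + x.a.imK * y.b.re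
        - x.b.re * y.a.imK - x.b.imI * y.a.imJ + x.b.imJ * y.a.imI + x.b.imK * y.a.re) := by
  ext <;> simp [ofCoords] <;> ring

theorem ofCoords_mul (r₀ r₁ r₂ r₃ r₄ r₅ r₆ r₇ t₀ t₁ t₂ t₃ t₄ t₅ t₆ t₇ : ℝ) :
    ofCoords r₀ r₁ r₂ r₃ r₄ r₅ r₆ r₇ * ofCoords t₀ t₁ t₂ t₃ t₄ t₅ t₆ t₇ =
      ofCoords
        (r₀ * t₀ - r₁ * t₁ - r₂ * t₂ - r₃ * t₃ - r₄ * t₄ - r₅ * t₅ - r₆ * t₆ - r₇ * t₇)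
        (r₀ * t₁ + r₁ * t₀ + r₂ * t₃ - r₃ * t₂ + r₄ * t₅ - r₅ * t₄ - r₆ * t₇ + r₇ * t₆)
        (r₀ * t₂ - r₁ * t₃ + r₂ * t₀ + r₃ * t₁ + r₄ * t₆ + r₅ * t₇ - r₆ * t₄ - r₇ * t₅)
        (r₀ * t₃ + r₁ * t₂ - r₂ * t₁ + r₃ * t₀ + r₄ * t₇ - r₅ * t₆ + r₆ * t₅ - r₇ * t₄)
        (r₀ * t₄ - r₁ * t₅ - r₂ * t₆ - r₃ * t₇ + r₄ * t₀ + r₅ * t₁ + r₆ * t₂ + r₇ * t₃)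
        (r₀ * t₅ + r₁ * t₄ - r₂ * t₇ + r₃ * t₆ - r₄ * t₁ + r₅ * t₀ - r₆ * t₃ + r₇ * t₂)
        (r₀ * t₆ + r₁ * t₇ + r₂ * t₄ - r₃ * t₅ - r₄ * t₂ + r₅ * t₃ + r₆ * t₀ - r₇ * t₁)
        (r₀ * t₇ - r₁ * t₆ + r₂ * t₅ + r₃ * t₄ - r₄ * t₃ - r₅ * t₂ + r₆ * t₁ + r₇ * t₀) :=
  mul_eq_ofCoords _ _

theorem ofCoords_add (r₀ r₁ r₂ r₃ r₄ r₅ r₆ r₇ t₀ t₁ t₂ t₃ t₄ t₅ t₆ t₇ : ℝ) :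
    ofCoords r₀ r₁ r₂ r₃ r₄ r₅ r₆ r₇ + ofCoords t₀ t₁ t₂ t₃ t₄ t₅ t₆ t₇ =
      ofCoords (r₀ + t₀) (r₁ + t₁) (r₂ + t₂) (r₃ + t₃) (r₄ + t₄) (r₅ + t₅) (r₆ + t₆)
        (r₇ + t₇) := rfl

theorem ofCoords_neg (r₀ r₁ r₂ r₃ r₄ r₅ r₆ r₇ : ℝ) :
    -ofCoords r₀ r₁ r₂ r₃ r₄ r₅ r₆ r₇ =
      ofCoords (-r₀) (-r₁) (-r₂) (-r₃) (-r₄) (-r₅) (-r₆) (-r₇) := rfl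

theorem ofCoords_sub (r₀ r₁ r₂ r₃ r₄ r₅ r₆ r₇ t₀ t₁ t₂ t₃ t₄ t₅ t₆ t₇ : ℝ) :
    ofCoords r₀ r₁ r₂ r₃ r₄ r₅ r₆ r₇ - ofCoords t₀ t₁ t₂ t₃ t₄ t₅ t₆ t₇ =
      ofCoords (r₀ - t₀) (r₁ - t₁) (r₂ - t₂) (r₃ - t₃) (r₄ - t₄) (r₅ - t₅) (r₆ - t₆)
        (r₇ - t₇) := rfl

theorem ofCoords_smul (c r₀ r₁ r₂ r₃ r₄ r₅ r₆ r₇ : ℝ) :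
    c • ofCoords r₀ r₁ r₂ r₃ r₄ r₅ r₆ r₇ =
      ofCoords (c * r₀) (c * r₁) (c * r₂) (c * r₃) (c * r₄) (c * r₅) (c * r₆) (c * r₇) := rfl

theorem conj_ofCoords (r₀ r₁ r₂ r₃ r₄ r₅ r₆ r₇ : ℝ) :
    conj (ofCoords r₀ r₁ r₂ r₃ r₄ r₅ r₆ r₇) =
      ofCoords r₀ (-r₁) (-r₂) (-r₃) (-r₄) (-r₅) (-r₆) (-r₇) := by
  have h (x : Oct) : conj x = ofCoords x.a.re (-x.a.imI) (-x.a.imJ) (-x.a.imK) (-x.b.re)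
      (-x.b.imI) (-x.b.imJ) (-x.b.imK) := by
    ext <;> simp [ofCoords]
  exact h _

theorem re_ofCoords (r₀ r₁ r₂ r₃ r₄ r₅ r₆ r₇ : ℝ) :
    re (ofCoords r₀ r₁ r₂ r₃ r₄ r₅ r₆ r₇) = r₀ := rfl

theorem e_zero : e 0 = 1 := rfl
theorem e_one : e 1 = ofCoords 0 1 0 0 0 0 0 0 := rfl
theorem e_two : e 2 = ofCoords 0 0 1 0 0 0 0 0 := rfl
theorem e_three : e 3 = ofCoords 0 0 0 1 0 0 0 0 := rfl
theorem e_four : e 4 = ofCoords 0 0 0 0 1 0 0 0 := rfl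
theorem e_five : e 5 = ofCoords 0 0 0 0 0 1 0 0 := rfl
theorem e_six : e 6 = ofCoords 0 0 0 0 0 0 1 0 := rfl
theorem e_seven : e 7 = ofCoords 0 0 0 0 0 0 0 1 := rfl

/-- The octonions are alternative. -/
instance : IsAlternativeRing Oct where
  associator_left_self x y := by
    rw [associator_apply, sub_eq_zero, eq_ofCoords x, eq_ofCoords y]
    simp only [ofCoords_mul]
    congr 1 <;> ring
  associator_right_self x y := by
    rw [associator_apply, sub_eq_zero, eq_ofCoords x, eq_ofCoords y]
    simp only [ofCoords_mul]
    congr 1 <;> ring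

theorem norm_sq_ofCoords (r₀ r₁ r₂ r₃ r₄ r₅ r₆ r₇ : ℝ) :
    ‖ofCoords r₀ r₁ r₂ r₃ r₄ r₅ r₆ r₇‖ ^ 2 =
      r₀ ^ 2 + r₁ ^ 2 + r₂ ^ 2 + r₃ ^ 2 + (r₄ ^ 2 + r₅ ^ 2 + r₆ ^ 2 + r₇ ^ 2) := by
  have h (q : Quaternion ℝ) : ‖q‖ ^ 2 = q.re ^ 2 + q.imI ^ 2 + q.imJ ^ 2 + q.imK ^ 2 := by
    rw [← Quaternion.normSq_def', Quaternion.normSq_eq_norm_mul_self, sq]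
  have h' := WithLp.prod_norm_sq_eq_of_L2 (toLp (ofCoords r₀ r₁ r₂ r₃ r₄ r₅ r₆ r₇))
  rw [h, h] at h'
  exact h'

protected theorem norm_mul (x y : Oct) : ‖x * y‖ = ‖x‖ * ‖y‖ := by
  rw [← sq_eq_sq₀ (norm_nonneg _) (by positivity), mul_pow, eq_ofCoords x, eq_ofCoords y]
  simp only [ofCoords_mul, norm_sq_ofCoords]
  ring

theorem norm_conj (x : Oct) : ‖conj x‖ = ‖x‖ := by
  rw [← sq_eq_sq₀ (norm_nonneg _) (norm_nonneg _), eq_ofCoords x]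
  simp only [conj_ofCoords, norm_sq_ofCoords]
  ring

protected theorem norm_one : ‖(1 : Oct)‖ = 1 := by
  rw [← sq_eq_sq₀ (norm_nonneg _) zero_le_one, one_eq_ofCoords, norm_sq_ofCoords]
  norm_num

theorem conj_eq (x : Oct) : conj x = (2 * re x) • (1 : Oct) - x := by
  rw [eq_ofCoords x]
  simp only [conj_ofCoords, one_eq_ofCoords, re_ofCoords, ofCoords_smul, ofCoords_sub]
  congr 1 <;> ring

theorem mul_self_eq (x : Oct) : x * x = (2 * re x) • x - (‖x‖ ^ 2) • (1 : Oct) := by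
  rw [eq_ofCoords x]
  simp only [norm_sq_ofCoords, ofCoords_mul, one_eq_ofCoords, re_ofCoords, ofCoords_smul,
    ofCoords_sub]
  congr 1 <;> ring

theorem mul_conj (x : Oct) : x * conj x = (‖x‖ ^ 2) • (1 : Oct) := by
  rw [conj_eq, mul_sub, mul_smul_comm, Oct.mul_one, mul_self_eq, sub_sub_cancel]

theorem conj_mul (x : Oct) : conj x * x = (‖x‖ ^ 2) • (1 : Oct) := by
  rw [conj_eq, sub_mul, smul_mul_assoc, Oct.one_mul, mul_self_eq, sub_sub_cancel]

theorem norm_oinv (s : Oct) : ‖oinv s‖ = ‖s‖⁻¹ := by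
  rw [oinv, norm_smul, norm_conj, norm_inv, norm_pow, norm_norm]
  by_cases h : ‖s‖ = 0
  · simp [h]
  · field_simp

theorem mul_oinv {s : Oct} (hs : s ≠ 0) : s * oinv s = 1 := by
  rw [oinv, mul_smul_comm, mul_conj, smul_smul, inv_mul_cancel₀ (by simpa using hs), one_smul]

theorem oinv_mul {s : Oct} (hs : s ≠ 0) : oinv s * s = 1 := by
  rw [oinv, smul_mul_assoc, conj_mul, smul_smul, inv_mul_cancel₀ (by simpa using hs), one_smul]

theorem norm_opow (s : Oct) (n : ℕ) : ‖opow s n‖ = ‖s‖ ^ n := by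
  induction n with
  | zero => simpa [opow] using Oct.norm_one
  | succ n ih => rw [opow, Oct.norm_mul, ih, pow_succ']

/-- The real subalgebra `ℝ + ℝ s` generated by an octonion. -/
def realSpan (s : Oct) : Submodule ℝ Oct := Submodule.span ℝ {1, s}

theorem mem_realSpan {s x : Oct} : x ∈ realSpan s ↔ ∃ a b : ℝ, a • (1 : Oct) + b • s = x :=
  Submodule.mem_span_pair

theorem mul_mem_realSpan {s x y : Oct} (hx : x ∈ realSpan s) (hy : y ∈ realSpan s) :
    x * y ∈ realSpan s := by
  obtain ⟨a, b, rfl⟩ := mem_realSpan.1 hx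
  obtain ⟨c, d, rfl⟩ := mem_realSpan.1 hy
  refine mem_realSpan.2 ⟨a * c - b * d * ‖s‖ ^ 2, a * d + b * c + b * d * (2 * re s), ?_⟩
  simp only [mul_add, add_mul, mul_smul_comm, smul_mul_assoc, Oct.one_mul, Oct.mul_one,
    mul_self_eq s]
  module

theorem oinv_mem_realSpan (s : Oct) : oinv s ∈ realSpan s :=
  mem_realSpan.2 ⟨(‖s‖ ^ 2)⁻¹ * (2 * re s), -(‖s‖ ^ 2)⁻¹, by rw [oinv, conj_eq]; module⟩

theorem opow_oinv_mem_realSpan (s : Oct) (n : ℕ) : opow (oinv s) n ∈ realSpan s := by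
  induction n with
  | zero => exact Submodule.subset_span (by simp [opow])
  | succ n ih => exact mul_mem_realSpan (oinv_mem_realSpan s) ih

theorem mul_invPow {s : Oct} (hs : s ≠ 0) (n : ℕ) : s * invPow s n = opow (oinv s) n := by
  obtain ⟨a, b, h⟩ := mem_realSpan.1 (oinv_mem_realSpan s)
  have h' : associator s (oinv s) (opow (oinv s) n) = 0 := by
    have h₁ := IsAlternativeRing.associator_left_self s (opow (oinv s) n)
    rw [associator_apply, sub_eq_zero] at h₁ ⊢
    generalize opow (oinv s) n = w at h₁ ⊢
    rw [← h]
    simp only [add_mul, mul_add, smul_mul_assoc, mul_smul_comm, Oct.one_mul, Oct.mul_one, h₁]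
  rw [associator_apply, mul_oinv hs, sub_eq_zero, Oct.one_mul] at h'
  exact h'.symm

theorem mul_comm_of_mem_realSpan {s x y : Oct} (hx : x ∈ realSpan s) (hy : y ∈ realSpan s) :
    x * y = y * x := by
  obtain ⟨a, b, rfl⟩ := mem_realSpan.1 hx
  obtain ⟨c, d, rfl⟩ := mem_realSpan.1 hy
  simp only [mul_add, add_mul, mul_smul_comm, smul_mul_assoc, Oct.one_mul, Oct.mul_one]
  module

theorem self_mem_realSpan (s : Oct) : s ∈ realSpan s := Submodule.subset_span (by simp)

theorem invPow_mul {s : Oct} (hs : s ≠ 0) (n : ℕ) : invPow s n * s = opow (oinv s) n := by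
  rw [← mul_invPow hs]
  exact mul_comm_of_mem_realSpan (opow_oinv_mem_realSpan s (n + 1)) (self_mem_realSpan s)

theorem sum_re_mul (q : Oct) :
    (5 / 12 : ℝ) • q - (1 / 12 : ℝ) • ∑ i : Fin 7, (e i.succ * q) * e i.succ = re q • (1 : Oct) := by
  rw [eq_ofCoords q]
  simp only [Fin.sum_univ_seven]
  change _ - (1 / 12 : ℝ) • (e 1 * _ * e 1 + e 2 * _ * e 2 + e 3 * _ * e 3 + e 4 * _ * e 4 +
    e 5 * _ * e 5 + e 6 * _ * e 6 + e 7 * _ * e 7) = _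
  simp only [e_one, e_two, e_three, e_four, e_five, e_six, e_seven, one_eq_ofCoords, ofCoords_mul,
    ofCoords_add, ofCoords_smul, ofCoords_sub, re_ofCoords]
  congr 1 <;> ring

theorem sum_re_mul_conj_smul (q : Oct) : ∑ i : Fin 8, re (q * conj (e i)) • e i = q := by
  rw [eq_ofCoords q]
  simp only [Fin.sum_univ_eight, e_zero, e_one, e_two, e_three, e_four, e_five, e_six, e_seven,
    one_eq_ofCoords, conj_ofCoords, ofCoords_mul, ofCoords_add, ofCoords_smul, re_ofCoords]
  congr 1 <;> ring

theorem re_mul_comm (p q : Oct) : re (p * q) = re (q * p) := by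
  rw [eq_ofCoords p, eq_ofCoords q]
  simp only [ofCoords_mul, re_ofCoords]
  ring

theorem re_mul_assoc (p q r : Oct) : re (p * q * r) = re (p * (q * r)) := by
  rw [eq_ofCoords p, eq_ofCoords q, eq_ofCoords r]
  simp only [ofCoords_mul, re_ofCoords]
  ring

theorem e_mul_self {m : Fin 8} (hm : m ≠ 0) : e m * e m = -1 := by
  fin_cases m
  · exact absurd rfl hm
  all_goals
    simp [e_one, e_two, e_three, e_four, e_five, e_six, e_seven, ofCoords_mul, one_eq_ofCoords,
      ofCoords_neg]

theorem e_mul_e_anticomm {m n : Fin 8} (hm : m ≠ 0) (hn : n ≠ 0) (hmn : m ≠ n) :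
    e m * e n = -(e n * e m) := by
  fin_cases m <;> fin_cases n <;> first
  | exact absurd rfl hm
  | exact absurd rfl hn
  | exact absurd rfl hmn
  | simp [e_one, e_two, e_three, e_four, e_five, e_six, e_seven, ofCoords_mul, ofCoords_neg]

end Oct

namespace Oct

open IsAlternativeRing

variable {A : Type*} [NonAssocRing A] [Module ℝ A] {f : Oct →ₙₐ[ℝ] A}

theorem map_e_mul_self (hf : f 1 = 1) {m : Fin 8} (hm : m ≠ 0) : f (e m) * f (e m) = -1 := by
  rw [← map_mul, e_mul_self hm, map_neg, hf]

variable [IsAlternativeRing A]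

theorem map_e_mul_left (hf : f 1 = 1) {m : Fin 8} (hm : m ≠ 0) (x : A) :
    f (e m) * (f (e m) * x) = -x := by
  have h := associator_left_self (f (e m)) x
  rw [associator_apply, map_e_mul_self hf hm, neg_mul, one_mul, sub_eq_zero] at h
  exact h.symm

theorem map_e_mul_right (hf : f 1 = 1) {m : Fin 8} (hm : m ≠ 0) (x : A) :
    x * f (e m) * f (e m) = -x := by
  have h := associator_right_self (f (e m)) x
  rw [associator_apply, map_e_mul_self hf hm, mul_neg, mul_one, sub_eq_zero] at h
  exact h

theorem associator_map_e_eq_zero (hf : f 1 = 1) {m : Fin 8} (hm : m ≠ 0) {y : A}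
    (hy : f (e m) * y = y * f (e m)) (x : A) : associator (f (e m)) x y = 0 := by
  have : IsAddTorsionFree A := .of_isTorsionFree ℝ A
  refine associator_eq_zero_of_commute (map_e_mul_left hf hm) (fun x y => ?_) hy x
  rw [map_e_mul_self hf hm]
  simp [associator_apply]

theorem map_e_mul_commute (hf : f 1 = 1) {v : A} {m n : Fin 8} (hm : m ≠ 0) (hn : n ≠ 0)
    (hmn : m ≠ n) (hv : f (e m) * v = v * f (e m)) (hv' : f (e n) * v = -(v * f (e n))) :
    f (e n) * (f (e m) * v) = f (e m) * v * f (e n) := by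
  have h := associator_map_e_eq_zero hf hm hv (f (e n))
  have k₁ : associator (f (e n)) (f (e m)) v = 0 := by rw [associator_swap_left, h, neg_zero]
  have k₂ : associator (f (e m)) v (f (e n)) = 0 := by rw [associator_swap_right, h, neg_zero]
  simp only [associator_apply, sub_eq_zero] at h k₁ k₂
  rw [← k₁, k₂, ← map_mul, e_mul_e_anticomm hn hm hmn.symm, map_neg, map_mul, neg_mul, h, hv',
    mul_neg, neg_neg]

theorem map_e_sandwich_sandwich (hf : f 1 = 1) {m : Fin 8} (hm : m ≠ 0) (v : A) :
    f (e m) * ((f (e m) * (v * f (e m))) * f (e m)) = v := by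
  rw [← flexible, map_e_mul_left hf hm, neg_mul, map_e_mul_right hf hm, neg_neg]

theorem map_e_sandwich_comm (hf : f 1 = 1) {m n : Fin 8} (hm : m ≠ 0) (hn : n ≠ 0)
    (hmn : m ≠ n) (v : A) :
    f (e m) * ((f (e n) * (v * f (e n))) * f (e m)) =
      f (e n) * ((f (e m) * (v * f (e m))) * f (e n)) := by
  refine sandwich_comm (map_e_mul_left hf hm) (map_e_mul_right hf hm) ?_ v
  rw [← map_mul, e_mul_e_anticomm hm hn hmn, map_neg, neg_mul, map_mul, map_e_mul_right hf hm,
    neg_neg]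

/-- If `v` anticommutes with the images of all imaginary basis octonions, then `v = 0`. -/
theorem eq_zero_of_anticomm (hf : f 1 = 1) {v : A}
    (hv : ∀ m : Fin 8, m ≠ 0 → f (e m) * v = -(v * f (e m))) : v = 0 := by
  have : IsAddTorsionFree A := .of_isTorsionFree ℝ A
  have key (p q : Oct) (hp : f p * v = -(v * f p)) (hq : f q * v = -(v * f q))
      (hpq : f (p * q) * v = -(v * f (p * q))) :
      f p * (f q * v) = -(f (p * q) * v) ∧ (f p * v) * f q = -(f (p * q) * v) := by
    have h₁ := commutator_mul (f p) (f q) v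
    have h₂ := associator_swap_right (f p) v (f q)
    have h₃ : f p * (v * f q) = -(f p * (f q * v)) := by rw [hq, mul_neg, neg_neg]
    have h₄ : v * f p * f q = -(f p * v * f q) := by rw [hp, neg_mul, neg_neg]
    have h₅ : v * f (p * q) = -(f (p * q) * v) := by rw [hpq, neg_neg]
    simp only [mul_sub, sub_mul, h₃, h₄, ← map_mul, h₅, associator_apply] at h₁ h₂
    constructor
    · linear_combination (norm := module) h₁ + (2 : ℤ) • h₂
    · linear_combination (norm := module) h₂
  have t₁₂ : e 1 * e 2 = e 3 := by simp [e_one, e_two, e_three, ofCoords_mul]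
  have t₃₄ : e 3 * e 4 = e 7 := by simp [e_seven, e_four, e_three, ofCoords_mul]
  have t₂₄ : e 2 * e 4 = e 6 := by simp [e_two, e_four, e_six, ofCoords_mul]
  have t₁₆ : e 1 * e 6 = -e 7 := by simp [e_one, e_seven, e_six, ofCoords_mul, ofCoords_neg]
  have t₆₁ : e 6 * e 1 = e 7 := by simp [e_one, e_seven, e_six, ofCoords_mul]
  have t₄₁ : e 4 * e 1 = -e 5 := by simp [e_one, e_four, e_five, ofCoords_mul, ofCoords_neg]
  have t₂₅ : e 2 * e 5 = e 7 := by simp [e_two, e_five, e_seven, ofCoords_mul]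
  have hneg (m : Fin 8) (hm : m ≠ 0) : f (-e m) * v = -(v * f (-e m)) := by
    rw [map_neg, neg_mul, hv m hm, mul_neg]
  have k₂₄ := (key (e 2) (e 4) (hv 2 (by decide)) (hv 4 (by decide))
    (by rw [t₂₄]; exact hv 6 (by decide))).1
  have k₃₄ := (key (e 3) (e 4) (hv 3 (by decide)) (hv 4 (by decide))
    (by rw [t₃₄]; exact hv 7 (by decide))).1
  have k₁₆ := (key (e 1) (e 6) (hv 1 (by decide)) (hv 6 (by decide))
    (by rw [t₁₆]; exact hneg 7 (by decide))).1
  have k₆₁ := (key (e 6) (e 1) (hv 6 (by decide)) (hv 1 (by decide))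
    (by rw [t₆₁]; exact hv 7 (by decide))).2
  have k₄₁ := (key (e 4) (e 1) (hv 4 (by decide)) (hv 1 (by decide))
    (by rw [t₄₁]; exact hneg 5 (by decide))).2
  have k₂₅ := (key (e 2) (e 5) (hv 2 (by decide)) (hv 5 (by decide))
    (by rw [t₂₅]; exact hv 7 (by decide))).1
  rw [t₂₄] at k₂₄
  rw [t₃₄] at k₃₄
  rw [t₁₆, map_neg, neg_mul, neg_neg] at k₁₆
  rw [t₆₁] at k₆₁
  rw [t₄₁, map_neg, neg_mul, neg_neg] at k₄₁
  rw [t₂₅] at k₂₅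
  have h := associator_rotate (f (e 1)) (f (e 2)) (f (e 4) * v)
  rw [associator_apply, associator_apply, ← map_mul f (e 1) (e 2), t₁₂, k₃₄, k₂₄, mul_neg, k₁₆,
    sub_self, k₄₁, k₂₅, neg_mul, k₆₁, neg_neg, sub_neg_eq_add, ← two_nsmul] at h
  rw [← neg_eq_zero, ← map_e_mul_left hf (show (7 : Fin 8) ≠ 0 by decide),
    (smul_eq_zero_iff_right two_ne_zero).1 h.symm, mul_zero]

end Oct

namespace Oct

open IsAlternativeRing

variable {A : Type*} [NonAssocRing A] [Module ℝ A] [IsScalarTower ℝ A A] {f : Oct →ₙₐ[ℝ] A}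

theorem associator_map_mem_span {y : A} (x : A) {S : Set Oct}
    (hS : ∀ p ∈ S, associator (f p) x y = 0) {p : Oct} (hp : p ∈ Submodule.span ℝ S) :
    associator (f p) x y = 0 := by
  simp only [associator_apply, sub_eq_zero] at hS ⊢
  induction hp using Submodule.span_induction with
  | mem p hp => exact hS p hp
  | zero => simp
  | add p q _ _ hp hq => simp only [map_add, add_mul, hp, hq]
  | smul c p _ hp => simp only [map_smul, smul_mul_assoc, hp]

theorem mem_span_of_b_eq_zero {p : Oct} (hp : p.b = 0) :
    p ∈ Submodule.span ℝ ({1, e 1, e 2, e 3} : Set Oct) := by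
  have h : p = p.a.re • (1 : Oct) + p.a.imI • e 1 + p.a.imJ • e 2 + p.a.imK • e 3 := by
    have hb : p = ofCoords p.a.re p.a.imI p.a.imJ p.a.imK 0 0 0 0 := Oct.ext rfl hp
    nth_rewrite 1 [hb]
    simp only [e_one, e_two, e_three, one_eq_ofCoords, ofCoords_smul, ofCoords_add]
    congr 1 <;> ring
  rw [h]
  refine add_mem (add_mem (add_mem ?_ ?_) ?_) ?_ <;>
    exact Submodule.smul_mem _ _ (Submodule.subset_span (by simp))

theorem mem_span_e (p : Oct) : p ∈ Submodule.span ℝ (Set.range e) := by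
  rw [← sum_re_mul_conj_smul p]
  exact sum_mem fun i _ => Submodule.smul_mem _ _ (Submodule.subset_span ⟨i, rfl⟩)

variable [IsAlternativeRing A]

/-- An element commuting with `e_1` and `e_2` associates with all octonions. -/
theorem associator_map_eq_zero (hf : f 1 = 1) {y : A} (h₁ : f (e 1) * y = y * f (e 1))
    (h₂ : f (e 2) * y = y * f (e 2)) (p q : Oct) : associator (f p) (f q) y = 0 := by
  have a₁ := associator_map_e_eq_zero hf (m := 1) (by decide) h₁
  have a₂ := associator_map_e_eq_zero hf (m := 2) (by decide) h₂
  have h₃ : f (e 3) * y = y * f (e 3) := by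
    have h := commutator_mul (f (e 1)) (f (e 2)) y
    have t₁₂ : e 1 * e 2 = e 3 := by simp [e_one, e_two, e_three, ofCoords_mul]
    rw [a₁, h₁, h₂, sub_self, sub_self, mul_zero, zero_mul, smul_zero, add_zero, add_zero,
      ← map_mul, t₁₂, sub_eq_zero] at h
    exact h
  have a₃ := associator_map_e_eq_zero hf (m := 3) (by decide) h₃
  have hH (p : Oct) (hp : p.b = 0) (x : A) : associator (f p) x y = 0 := by
    refine associator_map_mem_span x ?_ (mem_span_of_b_eq_zero hp)
    simp only [Set.mem_insert_iff, Set.mem_singleton_iff]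
    rintro p (rfl | rfl | rfl | rfl)
    · simp [associator_apply, hf]
    · exact a₁ x
    · exact a₂ x
    · exact a₃ x
  have hL (p q : Oct) (hp : p.a = 0) (hq : q.a = 0) : associator (f p) (f q) y = 0 := by
    by_cases hp0 : p = 0
    · simp [hp0, associator_apply]
    have hq' : q = q * oinv p * p := by
      have h := associator_right_self p q
      rw [associator_apply, sub_eq_zero] at h
      have h' : q * (oinv p * p) = q * oinv p * p := by
        obtain ⟨a, b, h''⟩ := mem_realSpan.1 (oinv_mem_realSpan p)
        rw [← h'']
        simp only [add_mul, mul_add, smul_mul_assoc, mul_smul_comm, Oct.one_mul, Oct.mul_one, h]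
      rw [← h', oinv_mul hp0, Oct.mul_one]
    have hb : (q * oinv p).b = 0 := by simp [oinv, hp, hq]
    rw [hq', map_mul, associator_mul_self_middle, associator_swap_left, hH _ hb, neg_zero,
      mul_zero]
  have hsplit (p : Oct) : p = ⟨p.a, 0⟩ + ⟨0, p.b⟩ := by ext1 <;> simp
  have hadd (p p' : Oct) (x : A) :
      associator (f (p + p')) x y = associator (f p) x y + associator (f p') x y := by
    simp only [map_add, associator_apply, add_mul]; abel
  rw [hsplit p, hadd, hH _ rfl, zero_add, associator_swap_left, hsplit q, hadd, hH _ rfl,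
    zero_add, hL _ _ rfl rfl, neg_zero]

/-- An element commuting with `e_1` and `e_2` commutes with all octonions. -/
theorem map_commute [SMulCommClass ℝ A A] (hf : f 1 = 1) {y : A} (h₁ : f (e 1) * y = y * f (e 1))
    (h₂ : f (e 2) * y = y * f (e 2)) (p : Oct) : f p * y = y * f p := by
  have : IsAddTorsionFree A := .of_isTorsionFree ℝ A
  have hass := associator_map_eq_zero hf h₁ h₂
  have t₁₂ : e 1 * e 2 = e 3 := by simp [e_one, e_two, e_three, ofCoords_mul]
  have t₁₄ : e 1 * e 4 = e 5 := by simp [e_one, e_four, e_five, ofCoords_mul]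
  have t₂₄ : e 2 * e 4 = e 6 := by simp [e_two, e_four, e_six, ofCoords_mul]
  have t₃₄ : e 3 * e 4 = e 7 := by simp [e_three, e_four, e_seven, ofCoords_mul]
  have hmul (p q : Oct) : f (p * q) * y - y * f (p * q)
      = f p * (f q * y - y * f q) + (f p * y - y * f p) * f q := by
    have h := commutator_mul (f p) (f q) y
    rw [hass, smul_zero, add_zero, ← map_mul] at h
    exact h
  have h₃ : f (e 3) * y = y * f (e 3) := by
    rw [← sub_eq_zero, ← t₁₂, hmul, h₁, h₂]; simp
  obtain ⟨c, hc⟩ : ∃ c, f (e 4) * y - y * f (e 4) = c := ⟨_, rfl⟩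
  have hc0 : c = 0 := by
    have hassc (p q : Oct) : associator (f p) (f q) c
        = associator (f p) (f q) (f (e 4)) * y - y * associator (f p) (f q) (f (e 4)) := by
      have k₁ := associator_cocycle (f p) (f q) (f (e 4)) y
      have k₂ := associator_cocycle y (f (e 4)) (f p) (f q)
      have r (u v : Oct) : associator y (f u) (f v) = 0 := by rw [associator_rotate, hass]
      have s₁ : associator (f p) (f q) (y * f (e 4))
          = associator (y * f (e 4)) (f p) (f q) := (associator_rotate _ _ _).symm
      have s₂ : associator (f (e 4)) (f p) (f q) = associator (f p) (f q) (f (e 4)) :=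
        associator_rotate _ _ _
      simp only [← map_mul, hass, r, mul_zero, zero_mul] at k₁ k₂
      have s₃ : associator (f p) (f q) c = associator (f p) (f q) (f (e 4) * y)
          - associator (f p) (f q) (y * f (e 4)) := by
        rw [← hc]; simp only [associator_apply, mul_sub]; abel
      rw [s₃, s₁]
      rw [s₂] at k₂
      linear_combination (norm := abel) -k₁ + k₂
    have hl : f (e 4) * c = -(c * f (e 4)) := by
      rw [← hc, mul_sub, sub_mul, map_e_mul_left hf (by decide), map_e_mul_right hf (by decide),
        flexible]
      abel
    have hcX (m : Fin 8) (hm : f (e m) * y = y * f (e m)) (hm4 : e 4 * e m = -(e m * e 4)) :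
        f (e m * e 4) * c = c * f (e m * e 4) := by
      have k₁ := hmul (e m) (e 4)
      have k₂ := hmul (e 4) (e m)
      rw [hm4, map_neg, neg_mul, mul_neg] at k₂
      rw [hc, hm, sub_self, zero_mul, add_zero] at k₁
      rw [hc, hm, sub_self, mul_zero, zero_add] at k₂
      have k₃ : f (e m) * c = -(c * f (e m)) := by
        rw [← k₁, ← k₂]; abel
      have k₄ : associator (f (e m)) (f (e 4)) c = 0 := by
        rw [hassc, associator_right_self, zero_mul, mul_zero, sub_self]
      have k₅ := commutator_mul (f (e m)) (f (e 4)) c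
      have k₆ : associator c (f (e m)) (f (e 4)) = 0 := by rw [associator_rotate, k₄]
      rw [k₄, smul_zero, add_zero, k₃, ← map_mul] at k₅
      have k₇ : c * f (e 4) = -(f (e 4) * c) := by rw [hl, neg_neg]
      rw [k₇] at k₅
      simp only [associator_apply, ← map_mul] at k₄ k₆
      rw [sub_eq_zero] at k₄ k₆
      simp only [sub_mul, mul_sub, neg_mul, mul_neg, k₆, ← k₄] at k₅
      rw [← sub_eq_zero]
      linear_combination (norm := abel) -k₅
    have c₅ := hcX 1 h₁ (e_mul_e_anticomm (by decide) (by decide) (by decide))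
    rw [t₁₄] at c₅
    have c₇ : f (e 7) * y = y * f (e 7) := by
      have h := associator_map_e_eq_zero hf (m := 5) (by decide) c₅ (f (e 6))
      have h' : associator (f (e 5)) (f (e 6)) (f (e 4)) = -((2 : ℕ) • f (e 7)) := by
        rw [associator_apply, ← map_mul, ← map_mul, ← map_mul, ← map_mul, ← map_sub, ← map_nsmul,
          ← map_neg]
        congr 1
        rw [two_nsmul]
        simp only [e_four, e_five, e_six, e_seven, ofCoords_mul, ofCoords_neg, ofCoords_sub,
          ofCoords_add]
        congr 1 <;> norm_num
      rw [hassc, h', neg_mul, mul_neg, smul_mul_assoc, mul_smul_comm, sub_neg_eq_add, neg_add_eq_sub,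
        ← smul_sub] at h
      exact (sub_eq_zero.1 ((smul_eq_zero_iff_right two_ne_zero).1 h)).symm
    have h := hmul (e 3) (e 4)
    rw [t₃₄, c₇, sub_self, h₃, sub_self, zero_mul, add_zero, hc] at h
    rw [← neg_eq_zero, ← map_e_mul_left hf (show (3 : Fin 8) ≠ 0 by decide), ← h, mul_zero]
  rw [hc0, sub_eq_zero] at hc
  have h₅ : f (e 5) * y = y * f (e 5) := by
    rw [← sub_eq_zero, ← t₁₄, hmul, h₁, hc]; simp
  have h₆ : f (e 6) * y = y * f (e 6) := by
    rw [← sub_eq_zero, ← t₂₄, hmul, h₂, hc]; simp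
  have h₇ : f (e 7) * y = y * f (e 7) := by
    rw [← sub_eq_zero, ← t₃₄, hmul, h₃, hc]; simp
  induction mem_span_e p using Submodule.span_induction with
  | mem p hp =>
    obtain ⟨i, rfl⟩ := hp
    fin_cases i
    · change f 1 * y = y * f 1
      rw [hf, one_mul, mul_one]
    · exact h₁
    · exact h₂
    · exact h₃
    · exact hc
    · exact h₅
    · exact h₆
    · exact h₇
  | zero => simp
  | add p q _ _ hp hq => rw [map_add, add_mul, mul_add, hp, hq]
  | smul a p _ hp => rw [map_smul, smul_mul_assoc, mul_smul_comm, hp]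

end Oct

namespace Oct

open IsAlternativeRing

variable {A : Type*} [NonAssocRing A] [IsAlternativeRing A] [Module ℝ A] [IsScalarTower ℝ A A]
  [SMulCommClass ℝ A A]

/-- `y` is real with respect to `f` if it commutes and associates with the image of `f`. -/
def IsReal (f : Oct →ₙₐ[ℝ] A) (y : A) : Prop :=
  (∀ p, f p * y = y * f p) ∧ ∀ p q, associator (f p) (f q) y = 0

/-- The span of the products of octonions and real elements. -/
def realSubmodule (f : Oct →ₙₐ[ℝ] A) : Submodule ℝ A :=
  Submodule.span ℝ {x | ∃ q r, IsReal f r ∧ x = f q * r}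

variable {f : Oct →ₙₐ[ℝ] A}

theorem isReal_of_commute (hf : f 1 = 1) {y : A} (h₁ : f (e 1) * y = y * f (e 1))
    (h₂ : f (e 2) * y = y * f (e 2)) : IsReal f y :=
  ⟨map_commute hf h₁ h₂, associator_map_eq_zero hf h₁ h₂⟩

theorem mem_realSubmodule_of_commute_or_anticomm (hf : f 1 = 1) {v : A}
    (hv : ∀ m : Fin 8, m ≠ 0 → f (e m) * v = v * f (e m) ∨ f (e m) * v = -(v * f (e m))) :
    v ∈ realSubmodule f := by
  have hmem (m : Fin 8) (hm : m ≠ 0) (h : IsReal f (f (e m) * v)) : v ∈ realSubmodule f := by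
    have : v = -(f (e m) * (f (e m) * v)) := by rw [map_e_mul_left hf hm, neg_neg]
    rw [this]
    exact neg_mem (Submodule.subset_span ⟨e m, _, h, rfl⟩)
  have hself (m : Fin 8) (h : f (e m) * v = v * f (e m)) :
      f (e m) * (f (e m) * v) = f (e m) * v * f (e m) := by
    rw [flexible, ← h]
  rcases hv 1 (by decide) with h₁ | h₁ <;> rcases hv 2 (by decide) with h₂ | h₂
  · exact Submodule.subset_span ⟨1, v, isReal_of_commute hf h₁ h₂, by rw [hf, one_mul]⟩
  · exact hmem 1 (by decide) (isReal_of_commute hf (hself 1 h₁)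
      (map_e_mul_commute hf (by decide) (by decide) (by decide) h₁ h₂))
  · exact hmem 2 (by decide) (isReal_of_commute hf
      (map_e_mul_commute hf (by decide) (by decide) (by decide) h₂ h₁) (hself 2 h₂))
  · by_cases h : ∃ m : Fin 8, m ≠ 0 ∧ m ≠ 1 ∧ m ≠ 2 ∧ f (e m) * v = v * f (e m)
    · obtain ⟨m, hm, hm₁, hm₂, h⟩ := h
      exact hmem m hm (isReal_of_commute hf
        (map_e_mul_commute hf hm (by decide) hm₁ h h₁)
        (map_e_mul_commute hf hm (by decide) hm₂ h h₂))
    · have : v = 0 := by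
        refine eq_zero_of_anticomm hf fun m hm => ?_
        by_cases hm₁ : m = 1
        · rwa [hm₁]
        by_cases hm₂ : m = 2
        · rwa [hm₂]
        exact (hv m hm).resolve_left fun h' => h ⟨m, hm, hm₁, hm₂, h'⟩
      rw [this]
      exact zero_mem _

/-- Every element is a combination of products of octonions and real elements. -/
theorem mem_realSubmodule (hf : f 1 = 1) (v : A) : v ∈ realSubmodule f := by
  suffices H : ∀ (k : ℕ) (v : A), (∀ m : Fin 8, k < m.val →
      f (e m) * (v * f (e m)) = -v ∨ f (e m) * (v * f (e m)) = v) → v ∈ realSubmodule f from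
    H 7 v fun m hm => absurd m.isLt (by omega)
  intro k
  induction k with
  | zero =>
    intro v hv
    refine mem_realSubmodule_of_commute_or_anticomm hf fun m hm => ?_
    have h' := map_e_mul_left hf hm (v * f (e m))
    refine (hv m (Fin.pos_of_ne_zero hm)).imp (fun h => ?_) fun h => ?_
    · rw [h, mul_neg, neg_inj] at h'
      exact h'
    · rw [h] at h'
      exact h'
  | succ k ih =>
    intro v hv
    by_cases hk : k + 1 < 8
    · obtain ⟨m, hmk⟩ : ∃ m : Fin 8, m.val = k + 1 := ⟨⟨k + 1, hk⟩, rfl⟩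
      have hm : m ≠ 0 := by rintro rfl; simp at hmk
      have hs := map_e_sandwich_sandwich hf hm v
      have hsplit : v = (2⁻¹ : ℝ) • (v - f (e m) * (v * f (e m)))
          + (2⁻¹ : ℝ) • (v + f (e m) * (v * f (e m))) := by module
      rw [hsplit]
      refine add_mem (Submodule.smul_mem _ _ (ih _ fun n hn => ?_))
        (Submodule.smul_mem _ _ (ih _ fun n hn => ?_))
      · by_cases hmn : m = n
        · subst hmn
          left
          rw [sub_mul, mul_sub, hs, neg_sub]
        · have hn0 : n ≠ 0 := by rintro rfl; simp at hn
          rw [sub_mul, mul_sub, map_e_sandwich_comm hf hn0 hm (Ne.symm hmn)]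
          refine (hv n (by omega)).imp (fun h => ?_) fun h => ?_ <;> rw [h]
          simp only [neg_mul, mul_neg]
          abel
      · by_cases hmn : m = n
        · subst hmn
          right
          rw [add_mul, mul_add, hs, add_comm]
        · have hn0 : n ≠ 0 := by rintro rfl; simp at hn
          rw [add_mul, mul_add, map_e_sandwich_comm hf hn0 hm (Ne.symm hmn)]
          refine (hv n (by omega)).imp (fun h => ?_) fun h => ?_ <;> rw [h]
          simp only [neg_mul, mul_neg]
          abel
    · exact ih v fun m hm => absurd m.isLt (by omega)

end Oct

/-- The split null extension `𝕆 ⊕ V` of the octonions by an `𝕆`-bimodule `V`. -/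
def OctExt (V : Type*) : Type _ := Oct × V

namespace OctExt

open OctBimodule

variable {V : Type*}

protected theorem ext {x y : OctExt V} (h₁ : x.1 = y.1) (h₂ : x.2 = y.2) : x = y :=
  Prod.ext h₁ h₂

variable [NormedAddCommGroup V]

instance : AddCommGroup (OctExt V) := inferInstanceAs (AddCommGroup (Oct × V))

instance : One (OctExt V) := ⟨(1, 0)⟩

theorem fst_add (x y : OctExt V) : (x + y).1 = x.1 + y.1 := rfl
theorem snd_add (x y : OctExt V) : (x + y).2 = x.2 + y.2 := rfl
theorem snd_sub (x y : OctExt V) : (x - y).2 = x.2 - y.2 := rfl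
theorem fst_zero : (0 : OctExt V).1 = 0 := rfl
theorem snd_zero : (0 : OctExt V).2 = 0 := rfl
theorem fst_one : (1 : OctExt V).1 = 1 := rfl
theorem snd_one : (1 : OctExt V).2 = 0 := rfl

variable [NormedSpace ℝ V]

instance : Module ℝ (OctExt V) := inferInstanceAs (Module ℝ (Oct × V))

theorem fst_smul (c : ℝ) (x : OctExt V) : (c • x).1 = c • x.1 := rfl
theorem snd_smul (c : ℝ) (x : OctExt V) : (c • x).2 = c • x.2 := rfl

variable [OctBimodule V]

instance : Mul (OctExt V) := ⟨fun x y => (x.1 * y.1, lm x.1 y.2 + rm y.1 x.2)⟩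

theorem fst_mul (x y : OctExt V) : (x * y).1 = x.1 * y.1 := rfl
theorem snd_mul (x y : OctExt V) : (x * y).2 = lm x.1 y.2 + rm y.1 x.2 := rfl

instance : NonAssocRing (OctExt V) :=
  { (inferInstance : AddCommGroup (OctExt V)), (inferInstance : Mul (OctExt V)),
    (inferInstance : One (OctExt V)) with
    left_distrib := fun x y z => OctExt.ext (mul_add _ _ _) <| by
      simp only [snd_mul, snd_add, fst_add, map_add, add_apply]
      abel
    right_distrib := fun x y z => OctExt.ext (add_mul _ _ _) <| by
      simp only [snd_mul, snd_add, fst_add, map_add, add_apply]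
      abel
    zero_mul := fun x => OctExt.ext (zero_mul _) <| by simp [snd_mul, fst_zero, snd_zero]
    mul_zero := fun x => OctExt.ext (mul_zero _) <| by simp [snd_mul, fst_zero, snd_zero]
    one_mul := fun x => OctExt.ext (Oct.one_mul _) <| by
      simp [snd_mul, fst_one, snd_one, lm_one]
    mul_one := fun x => OctExt.ext (Oct.mul_one _) <| by
      simp [snd_mul, fst_one, snd_one, rm_one] }

instance : IsScalarTower ℝ (OctExt V) (OctExt V) :=
  ⟨fun c x y => OctExt.ext (smul_mul_assoc _ _ _) <| by
    simp [snd_mul, fst_smul, snd_smul]⟩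

instance : SMulCommClass ℝ (OctExt V) (OctExt V) :=
  ⟨fun c x y => OctExt.ext (mul_smul_comm _ _ _).symm <| by
    simp [snd_mul, fst_smul, snd_smul]⟩

instance : IsAlternativeRing (OctExt V) where
  associator_left_self x y := by
    refine OctExt.ext (IsAlternativeRing.associator_left_self x.1 y.1) ?_
    have h₁ := assoc_alt x.1 x.1 y.2
    have h₂ := assoc_cyc₁ y.1 x.1 x.2
    have h₃ := assoc_cyc₂ x.1 y.1 x.2
    have h₄ := assoc_alt x.1 y.1 x.2
    simp only [associator_apply, snd_mul, snd_sub, fst_mul, map_add, snd_zero]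
    linear_combination (norm := module) (1 / 2 : ℝ) • h₁ - h₂ - h₃ + h₄
  associator_right_self x y := by
    refine OctExt.ext (IsAlternativeRing.associator_right_self x.1 y.1) ?_
    have h₁ := assoc_alt x.1 x.1 y.2
    have h₂ := assoc_cyc₂ x.1 x.1 y.2
    have h₃ := assoc_cyc₁ x.1 y.1 x.2
    have h₄ := assoc_alt x.1 y.1 x.2
    simp only [associator_apply, snd_mul, snd_sub, fst_mul, map_add, snd_zero]
    linear_combination (norm := module) (1 / 2 : ℝ) • h₁ - h₂ - h₃ + h₄

variable (V) in
/-- The inclusion of the octonions into the split null extension. -/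
def inl : Oct →ₙₐ[ℝ] OctExt V where
  toFun p := (p, 0)
  map_smul' c p := OctExt.ext rfl (smul_zero c).symm
  map_zero' := rfl
  map_add' p q := OctExt.ext rfl (add_zero 0).symm
  map_mul' p q := OctExt.ext rfl <| by
    change (0 : V) = lm p 0 + rm q 0
    simp

theorem snd_inl_mul (p : Oct) (x : OctExt V) : (inl V p * x).2 = lmo p x.2 := by
  change lm p x.2 + rm x.1 0 = lm p x.2
  simp

theorem snd_mul_inl (p : Oct) (x : OctExt V) : (x * inl V p).2 = rmo p x.2 := by
  change lm x.1 0 + rm p x.2 = rm p x.2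
  simp

theorem snd_mem_ReSet {r : OctExt V} (hr : Oct.IsReal (inl V) r) : r.2 ∈ ReSet V := by
  refine ⟨fun p q => ?_, fun p => ?_⟩
  · have h := congrArg (fun x : OctExt V => x.2) (hr.2 p q)
    simp only [associator_apply, snd_sub, ← map_mul, snd_inl_mul, snd_zero, sub_eq_zero] at h
    exact h
  · have h := congrArg (fun x : OctExt V => x.2) (hr.1 p)
    simpa only [snd_inl_mul, snd_mul_inl] using h

end OctExt

section Bimodule

variable {V : Type*} [NormedAddCommGroup V] [NormedSpace ℝ V] [OctBimodule V]

/-- Every element of an `𝕆`-bimodule is a combination of octonionic multiples of elements of the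
real part. -/
theorem mem_span_lmo_ReSet (x : V) :
    x ∈ Submodule.span ℝ {y : V | ∃ q, ∃ r ∈ ReSet V, y = lmo q r} := by
  have h : ∀ z ∈ Oct.realSubmodule (OctExt.inl V),
      z.2 ∈ Submodule.span ℝ {y : V | ∃ q, ∃ r ∈ ReSet V, y = lmo q r} := by
    intro z hz
    induction hz using Submodule.span_induction with
    | mem z hz =>
      obtain ⟨q, r, hr, rfl⟩ := hz
      exact Submodule.subset_span ⟨q, r.2, OctExt.snd_mem_ReSet hr, OctExt.snd_inl_mul q r⟩
    | zero => exact zero_mem _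
    | add y z _ _ hy hz => exact add_mem hy hz
    | smul c z _ hz => exact Submodule.smul_mem _ c hz
  exact h ((0, x) : Oct × V) (Oct.mem_realSubmodule rfl _)

theorem lmo_lmo_of_mem_ReSet {r : V} (hr : r ∈ ReSet V) (p q : Oct) :
    lmo p (lmo q r) = lmo (p * q) r := (hr.1 p q).symm

theorem rmo_lmo_of_mem_ReSet {r : V} (hr : r ∈ ReSet V) (p q : Oct) :
    rmo p (lmo q r) = lmo (q * p) r := by
  have h := OctBimodule.assoc_cyc₁ p q r
  have h₁ := OctBimodule.assoc_cyc₂ p q r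
  have h₂ := OctBimodule.assoc_cyc₂ q p r
  have k₁ := hr.1 p q
  have k₂ := hr.1 q p
  have k₃ := hr.2 p
  simp only [lmo, rmo] at *
  rw [k₁, sub_self, ← k₃, ← k₂, eq_comm, sub_eq_zero] at h
  exact h

theorem reO_lmo {r : V} (hr : r ∈ ReSet V) (q : Oct) : reO V (lmo q r) = re q • r := by
  have h := congrArg (fun p => lmo p r) (sum_re_mul q)
  have h₁ : lmo (1 : Oct) r = r := OctBimodule.lm_one r
  simp only [lmo, map_sub, map_smul, map_sum, sub_apply, smul_apply,
    sum_apply] at h h₁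
  rw [h₁] at h
  rw [← h]
  simp only [reO, sub_apply, smul_apply, sum_apply, ContinuousLinearMap.comp_apply,
    lmo_lmo_of_mem_ReSet hr, rmo_lmo_of_mem_ReSet hr, ContinuousLinearMap.id_apply]
  rfl

end Bimodule

theorem Oct.invPow_mem_realSpan (s : Oct) (n : ℕ) : invPow s n ∈ realSpan s :=
  opow_oinv_mem_realSpan s (n + 1)

section Normed

variable {V : Type*} [NormedAddCommGroup V]

theorem hasSum_eq_of_telescoping {f a : ℕ → V} {b c : V} (hf : HasSum f b)
    (h : ∀ n, f n = a n - a (n + 1)) (h₀ : a 0 = c)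
    (ha : Filter.Tendsto a Filter.atTop (nhds 0)) : b = c := by
  refine tendsto_nhds_unique hf.tendsto_sum_nat ?_
  simp only [h, Finset.sum_range_sub', h₀]
  simpa using ha.const_sub c

variable [NormedSpace ℝ V]

theorem opNorm_pow_le (S : V →L[ℝ] V) (n : ℕ) : ‖S ^ n‖ ≤ ‖S‖ ^ n := by
  rcases Nat.eq_zero_or_pos n with rfl | hn
  · rw [pow_zero, pow_zero]
    exact ContinuousLinearMap.norm_id_le
  · exact norm_pow_le' S hn

variable {T : V →L[ℝ] V} {s : Oct}

theorem ne_zero_of_norm_lt (hs : ‖T‖ < ‖s‖) : s ≠ 0 :=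
  norm_pos_iff.1 ((norm_nonneg T).trans_lt hs)

theorem norm_oinv_mul_norm_lt_one (hs : ‖T‖ < ‖s‖) : ‖oinv s‖ * ‖T‖ < 1 := by
  rw [norm_oinv, inv_mul_lt_one₀ ((norm_nonneg T).trans_lt hs)]
  exact hs

theorem norm_opow_mul_norm_pow_le (n : ℕ) :
    ‖opow (oinv s) n‖ * ‖T ^ n‖ ≤ (‖oinv s‖ * ‖T‖) ^ n := by
  rw [norm_opow, mul_pow]
  exact mul_le_mul_of_nonneg_left (opNorm_pow_le T n) (by positivity)

theorem norm_invPow_mul_norm_pow_le (n : ℕ) :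
    ‖invPow s n‖ * ‖T ^ n‖ ≤ ‖oinv s‖ * (‖oinv s‖ * ‖T‖) ^ n := by
  rw [invPow, opow, Oct.norm_mul, mul_assoc]
  exact mul_le_mul_of_nonneg_left (norm_opow_mul_norm_pow_le n) (norm_nonneg _)

theorem summable_invPow_bound (hs : ‖T‖ < ‖s‖) :
    Summable fun n : ℕ => 3 * (‖oinv s‖ * (‖oinv s‖ * ‖T‖) ^ n) :=
  ((summable_geometric_of_lt_one (by positivity)
    (norm_oinv_mul_norm_lt_one hs)).mul_left _).mul_left _

end Normed

section Bimodule

variable {V : Type*} [NormedAddCommGroup V] [NormedSpace ℝ V] [OctBimodule V]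

theorem eq_of_eq_on_lmo {F G : V →L[ℝ] V}
    (h : ∀ (q : Oct), ∀ r ∈ ReSet V, F (lmo q r) = G (lmo q r)) (x : V) : F x = G x := by
  induction mem_span_lmo_ReSet x using Submodule.span_induction with
  | mem z hz =>
    obtain ⟨q, r, hr, rfl⟩ := hz
    exact h q r hr
  | zero => simp
  | add y z _ _ hy hz => rw [map_add, map_add, hy, hz]
  | smul c z _ hz => rw [map_smul, map_smul, hz]

theorem zero_mem_ReSet : (0 : V) ∈ ReSet V := by simp [ReSet]

theorem add_mem_ReSet {x y : V} (hx : x ∈ ReSet V) (hy : y ∈ ReSet V) : x + y ∈ ReSet V :=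
  ⟨fun p q => by simp only [map_add, hx.1 p q, hy.1 p q],
    fun p => by simp only [map_add, hx.2 p, hy.2 p]⟩

theorem smul_mem_ReSet (c : ℝ) {x : V} (hx : x ∈ ReSet V) : c • x ∈ ReSet V :=
  ⟨fun p q => by simp only [map_smul, hx.1 p q], fun p => by simp only [map_smul, hx.2 p]⟩

theorem reO_mem_ReSet (x : V) : reO V x ∈ ReSet V := by
  induction mem_span_lmo_ReSet x using Submodule.span_induction with
  | mem z hz =>
    obtain ⟨q, r, hr, rfl⟩ := hz
    rw [reO_lmo hr]
    exact smul_mem_ReSet _ hr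
  | zero => rw [map_zero]; exact zero_mem_ReSet
  | add y z _ _ hy hz => rw [map_add]; exact add_mem_ReSet hy hz
  | smul c z _ hz => rw [map_smul]; exact smul_mem_ReSet c hz

theorem sum_rmo_reO_rmo_conj (x : V) :
    ∑ i : Fin 8, rmo (e i) (reO V (rmo (conj (e i)) x)) = x := by
  have h := eq_of_eq_on_lmo
    (F := ∑ i : Fin 8, (rmo (e i)).comp ((reO V).comp (rmo (conj (e i)))))
    (G := ContinuousLinearMap.id ℝ V) (fun q r hr => ?_) x
  · simpa only [sum_apply, ContinuousLinearMap.comp_apply, ContinuousLinearMap.id_apply] using h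
  · have h := congrArg (fun p => lmo p r) (sum_re_mul_conj_smul q)
    simp only [lmo, map_sum, map_smul, sum_apply, smul_apply] at h
    simp only [sum_apply, ContinuousLinearMap.comp_apply, ContinuousLinearMap.id_apply,
      rmo_lmo_of_mem_ReSet hr, reO_lmo hr, map_smul, ← hr.2]
    exact h

theorem reO_lmo_eq_reO_rmo (p : Oct) (x : V) : reO V (lmo p x) = reO V (rmo p x) :=
  eq_of_eq_on_lmo (F := (reO V).comp (lmo p)) (G := (reO V).comp (rmo p)) (fun q r hr => by
    simp only [ContinuousLinearMap.comp_apply, lmo_lmo_of_mem_ReSet hr, rmo_lmo_of_mem_ReSet hr,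
      reO_lmo hr, re_mul_comm p q]) x

theorem reO_rmo_rmo (p q : Oct) (x : V) : reO V (rmo q (rmo p x)) = reO V (rmo (p * q) x) :=
  eq_of_eq_on_lmo (F := (reO V).comp ((rmo q).comp (rmo p))) (G := (reO V).comp (rmo (p * q)))
    (fun a r hr => by
      simp only [ContinuousLinearMap.comp_apply, rmo_lmo_of_mem_ReSet hr, reO_lmo hr,
        re_mul_assoc]) x

theorem reO_rmo_lmo (p q : Oct) (x : V) : reO V (rmo q (lmo p x)) = reO V (rmo (q * p) x) :=
  eq_of_eq_on_lmo (F := (reO V).comp ((rmo q).comp (lmo p))) (G := (reO V).comp (rmo (q * p)))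
    (fun a r hr => by
      simp only [ContinuousLinearMap.comp_apply, rmo_lmo_of_mem_ReSet hr,
        lmo_lmo_of_mem_ReSet hr, reO_lmo hr, re_mul_assoc p, re_mul_comm p, re_mul_assoc a]) x

theorem eq_of_reO_rmo_eq {x y : V} (h : ∀ p, reO V (rmo p x) = reO V (rmo p y)) : x = y := by
  rw [← sum_rmo_reO_rmo_conj x, ← sum_rmo_reO_rmo_conj y]
  simp only [h]

theorem rmo_one (x : V) : rmo 1 x = x := OctBimodule.rm_one x

theorem rmo_add (p q : Oct) (x : V) : rmo (p + q) x = rmo p x + rmo q x := by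
  simp only [rmo, map_add, add_apply]

theorem rmo_smul (c : ℝ) (p : Oct) (x : V) : rmo (c • p) x = c • rmo p x := by
  simp only [rmo, map_smul, smul_apply]

theorem rmo_mul_add_rmo_mul (p q : Oct) (x : V) :
    rmo (p * q) x + rmo (q * p) x = rmo q (rmo p x) + rmo p (rmo q x) := by
  have h₁ := OctBimodule.assoc_cyc₂ p q x
  have h₂ := OctBimodule.assoc_cyc₂ q p x
  have h₃ := OctBimodule.assoc_alt p q x
  simp only [rmo]
  linear_combination (norm := module) h₁ + h₂ - h₃

theorem rmo_mul_self (p : Oct) (x : V) : rmo (p * p) x = rmo p (rmo p x) := by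
  have h := rmo_mul_add_rmo_mul p p x
  linear_combination (norm := module) (1 / 2 : ℝ) • h

theorem rmo_rmo_of_mem_realSpan {s p q : Oct} (hp : p ∈ realSpan s) (hq : q ∈ realSpan s)
    (x : V) : rmo q (rmo p x) = rmo (p * q) x := by
  obtain ⟨a, b, rfl⟩ := mem_realSpan.1 hp
  obtain ⟨c, d, rfl⟩ := mem_realSpan.1 hq
  simp only [add_mul, mul_add, smul_mul_assoc, mul_smul_comm, rmo_add, rmo_smul, map_add,
    map_smul, rmo_one, Oct.one_mul, Oct.mul_one, rmo_mul_self]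
  module

theorem rmo_rmo_of_mem_ReSet {r : V} (hr : r ∈ ReSet V) (p q : Oct) :
    rmo q (rmo p r) = rmo (p * q) r := by
  rw [← hr.2, ← hr.2, rmo_lmo_of_mem_ReSet hr]

namespace IsRightPara

variable {S : V →L[ℝ] V}

theorem reO_rmo (hS : IsRightPara S) (p : Oct) (x : V) :
    reO V (rmo p (S x)) = reO V (S (rmo p x)) := by
  have h := hS p x
  rwa [Bop, sub_apply, map_sub, sub_eq_zero] at h

theorem map_rmo (hS : IsRightPara S) {r : V} (hr : r ∈ ReSet V) (p : Oct) :
    S (rmo p r) = rmo p (S r) :=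
  eq_of_reO_rmo_eq fun q => by
    rw [hS.reO_rmo, rmo_rmo_of_mem_ReSet hr, reO_rmo_rmo, hS.reO_rmo]

theorem odotR_apply_of_mem_ReSet (hS : IsRightPara S) {r : V} (hr : r ∈ ReSet V) (p : Oct) :
    odotR S p r = rmo p (S r) := by
  simp only [odotR, Bop, sub_apply, ContinuousLinearMap.comp_apply, hr.2, hS.map_rmo hr]
  abel

theorem odotR_rmo (hS : IsRightPara S) {r : V} (hr : r ∈ ReSet V) (p q : Oct) :
    odotR S p (rmo q r) = rmo q (odotR S p r) := by
  rw [hS.odotR_apply_of_mem_ReSet hr]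
  have h := rmo_mul_add_rmo_mul p q (S r)
  simp only [odotR, Bop, sub_apply, ContinuousLinearMap.comp_apply]
  rw [rmo_rmo_of_mem_ReSet hr, ← hr.2 q, lmo_lmo_of_mem_ReSet hr, hr.2, hr.2, hS.map_rmo hr,
    hS.map_rmo hr, hS.map_rmo hr]
  linear_combination (norm := module) h

theorem reO_odotL (hS : IsRightPara S) (p : Oct) (x : V) :
    reO V (odotL p S x) = reO V (rmo p (S x)) := by
  rw [odotL, add_apply, map_add, hS p x, add_zero, ContinuousLinearMap.comp_apply,
    reO_lmo_eq_reO_rmo]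

theorem odotL (hS : IsRightPara S) (p : Oct) : IsRightPara (odotL p S) := by
  intro q x
  rw [Bop, sub_apply, map_sub]
  simp only [ContinuousLinearMap.comp_apply]
  rw [hS.reO_odotL]
  have h := congrArg (fun y => reO V (S y)) (rmo_mul_add_rmo_mul p q x)
  simp only [map_add] at h
  simp only [_root_.odotL, Bop, add_apply, sub_apply, ContinuousLinearMap.comp_apply, map_add,
    map_sub, reO_rmo_lmo, reO_rmo_rmo, hS.reO_rmo]
  linear_combination (norm := module) h

theorem lifO_reO_comp (hS : IsRightPara S) : lifO ((reO V).comp S) = S := by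
  ext x
  simp only [lifO, sum_apply, ContinuousLinearMap.comp_apply, ← hS.reO_rmo]
  exact sum_rmo_reO_rmo_conj _

end IsRightPara

theorem extO_eq {F U : V →L[ℝ] V} (hU : ∀ (q : Oct), ∀ r ∈ ReSet V, U (rmo q r) = rmo q (U r))
    (hF : ∀ r ∈ ReSet V, F r = U r) : extO F = U := by
  ext x
  simp only [extO, sum_apply, ContinuousLinearMap.comp_apply, hF _ (reO_mem_ReSet _),
    ← hU _ _ (reO_mem_ReSet _), ← map_sum]
  rw [sum_rmo_reO_rmo_conj]

theorem opNorm_lmo_le (p : Oct) : ‖(lmo p : V →L[ℝ] V)‖ ≤ ‖p‖ :=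
  ContinuousLinearMap.opNorm_le_bound _ (norm_nonneg _) fun x => (OctBimodule.norm_lm p x).le

theorem opNorm_rmo_le (p : Oct) : ‖(rmo p : V →L[ℝ] V)‖ ≤ ‖p‖ :=
  ContinuousLinearMap.opNorm_le_bound _ (norm_nonneg _) fun x => (OctBimodule.norm_rm p x).le

theorem norm_comp_lmo_le (S : V →L[ℝ] V) (p : Oct) : ‖S.comp (lmo p)‖ ≤ ‖p‖ * ‖S‖ :=
  (ContinuousLinearMap.opNorm_comp_le _ _).trans <| by
    rw [mul_comm]
    exact mul_le_mul_of_nonneg_right (opNorm_lmo_le p) (norm_nonneg _)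

theorem norm_comp_rmo_le (S : V →L[ℝ] V) (p : Oct) : ‖S.comp (rmo p)‖ ≤ ‖p‖ * ‖S‖ :=
  (ContinuousLinearMap.opNorm_comp_le _ _).trans <| by
    rw [mul_comm]
    exact mul_le_mul_of_nonneg_right (opNorm_rmo_le p) (norm_nonneg _)

theorem norm_lmo_comp_le (S : V →L[ℝ] V) (p : Oct) : ‖(lmo p).comp S‖ ≤ ‖p‖ * ‖S‖ :=
  (ContinuousLinearMap.opNorm_comp_le _ _).trans <|
    mul_le_mul_of_nonneg_right (opNorm_lmo_le p) (norm_nonneg _)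

theorem norm_rmo_comp_le (S : V →L[ℝ] V) (p : Oct) : ‖(rmo p).comp S‖ ≤ ‖p‖ * ‖S‖ :=
  (ContinuousLinearMap.opNorm_comp_le _ _).trans <|
    mul_le_mul_of_nonneg_right (opNorm_rmo_le p) (norm_nonneg _)

theorem norm_Bop_le (S : V →L[ℝ] V) (p : Oct) : ‖Bop p S‖ ≤ 2 * (‖p‖ * ‖S‖) := by
  refine (norm_sub_le _ _).trans ?_
  linarith [norm_rmo_comp_le S p, norm_comp_rmo_le S p]

theorem norm_odotR_le (S : V →L[ℝ] V) (p : Oct) : ‖odotR S p‖ ≤ 3 * (‖p‖ * ‖S‖) := by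
  refine (norm_sub_le _ _).trans ?_
  linarith [norm_comp_lmo_le S p, norm_Bop_le S p]

theorem norm_odotL_le (S : V →L[ℝ] V) (p : Oct) : ‖odotL p S‖ ≤ 3 * (‖p‖ * ‖S‖) := by
  refine (norm_add_le _ _).trans ?_
  linarith [norm_lmo_comp_le S p, norm_Bop_le S p]

variable {T : V →L[ℝ] V} {s : Oct}

theorem tendsto_rmo_opow_pow (hs : ‖T‖ < ‖s‖) (x : V) :
    Filter.Tendsto (fun n : ℕ => rmo (opow (oinv s) n) ((T ^ n) x)) Filter.atTop (nhds 0) := by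
  have h : Filter.Tendsto (fun n : ℕ => (‖oinv s‖ * ‖T‖) ^ n * ‖x‖) Filter.atTop (nhds 0) := by
    simpa using (tendsto_pow_atTop_nhds_zero_of_lt_one (by positivity)
      (norm_oinv_mul_norm_lt_one hs)).mul_const ‖x‖
  refine squeeze_zero_norm (fun n => ?_) h
  refine (((rmo (opow (oinv s) n)).comp (T ^ n)).le_opNorm x).trans ?_
  exact mul_le_mul_of_nonneg_right
    ((norm_rmo_comp_le _ _).trans (norm_opow_mul_norm_pow_le n)) (norm_nonneg _)

variable [CompleteSpace V]

theorem summable_odotR (hs : ‖T‖ < ‖s‖) : Summable fun n : ℕ => odotR (T ^ n) (invPow s n) :=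
  .of_norm_bounded (summable_invPow_bound hs) fun n => (norm_odotR_le _ _).trans <|
    mul_le_mul_of_nonneg_left (norm_invPow_mul_norm_pow_le n) (by norm_num)

theorem summable_odotL (hs : ‖T‖ < ‖s‖) : Summable fun n : ℕ => odotL (invPow s n) (T ^ n) :=
  .of_norm_bounded (summable_invPow_bound hs) fun n => (norm_odotL_le _ _).trans <|
    mul_le_mul_of_nonneg_left (norm_invPow_mul_norm_pow_le n) (by norm_num)

theorem isUnit_rmo_sub (hs : ‖T‖ < ‖s‖) : IsUnit ((rmo s : V →L[ℝ] V) - T) := by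
  have hs₀ := ne_zero_of_norm_lt hs
  have h₁ : (rmo s : V →L[ℝ] V) * rmo (oinv s) = 1 := by
    ext x
    change rmo s (rmo (oinv s) x) = x
    rw [rmo_rmo_of_mem_realSpan (oinv_mem_realSpan s) (self_mem_realSpan s), oinv_mul hs₀,
      rmo_one]
  have h₂ : (rmo (oinv s) : V →L[ℝ] V) * rmo s = 1 := by
    ext x
    change rmo (oinv s) (rmo s x) = x
    rw [rmo_rmo_of_mem_realSpan (self_mem_realSpan s) (oinv_mem_realSpan s), mul_oinv hs₀,
      rmo_one]
  have h₃ : (rmo s : V →L[ℝ] V) - T = rmo s * (1 - rmo (oinv s) * T) := by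
    rw [mul_sub, mul_one, ← mul_assoc, h₁, one_mul]
  rw [h₃]
  refine IsUnit.mul ⟨⟨_, _, h₁, h₂⟩, rfl⟩ (isUnit_one_sub_of_norm_lt_one ?_)
  exact (norm_rmo_comp_le T (oinv s)).trans_lt (norm_oinv_mul_norm_lt_one hs)

theorem rinvR_rmo_sub (hpa : IsPowerAssoc T) (hs : ‖T‖ < ‖s‖) :
    rinvR ((rmo s : V →L[ℝ] V) - T) = ∑' n : ℕ, odotR (T ^ n) (invPow s n) := by
  have hs₀ := ne_zero_of_norm_lt hs
  set X : V →L[ℝ] V := rmo s - T with hX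
  set G : V →L[ℝ] V := ∑' n : ℕ, odotR (T ^ n) (invPow s n) with hG
  have hsum (x : V) : HasSum (fun n : ℕ => odotR (T ^ n) (invPow s n) x) (G x) :=
    (summable_odotR hs).hasSum.mapL (ContinuousLinearMap.apply ℝ V x)
  refine extO_eq (fun q r hr => ?_) fun r hr => ?_
  · refine (hsum (rmo q r)).unique ?_
    simp only [(hpa _).odotR_rmo hr]
    exact (hsum r).mapL (rmo q)
  · have h : X (G r) = r := by
      refine hasSum_eq_of_telescoping (a := fun n => rmo (opow (oinv s) n) ((T ^ n) r))
        ((hsum r).mapL X) (fun n => ?_) (rmo_one r) (tendsto_rmo_opow_pow hs r)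
      have h₁ : rmo s (rmo (invPow s n) ((T ^ n) r)) = rmo (opow (oinv s) n) ((T ^ n) r) := by
        rw [rmo_rmo_of_mem_realSpan (invPow_mem_realSpan s n) (self_mem_realSpan s),
          invPow_mul hs₀]
      have h₂ : T (rmo (invPow s n) ((T ^ n) r)) =
          rmo (opow (oinv s) (n + 1)) ((T ^ (n + 1)) r) := by
        rw [← (hpa n).map_rmo hr, ← invPow, ← (hpa (n + 1)).map_rmo hr, pow_succ']
        rfl
      rw [(hpa n).odotR_apply_of_mem_ReSet hr, hX, sub_apply, h₁, h₂]
    rw [← h]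
    change (Ring.inverse X * X) (G r) = G (X (G r))
    rw [Ring.inverse_mul_cancel X (isUnit_rmo_sub hs), h]
    rfl

theorem rinvL_rmo_sub (hpa : IsPowerAssoc T) (hs : ‖T‖ < ‖s‖) :
    rinvL ((rmo s : V →L[ℝ] V) - T) = ∑' n : ℕ, odotL (invPow s n) (T ^ n) := by
  have hs₀ := ne_zero_of_norm_lt hs
  set X : V →L[ℝ] V := rmo s - T with hX
  set G : V →L[ℝ] V := ∑' n : ℕ, odotL (invPow s n) (T ^ n) with hG
  have hsum (x : V) : HasSum (fun n : ℕ => odotL (invPow s n) (T ^ n) x) (G x) :=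
    (summable_odotL hs).hasSum.mapL (ContinuousLinearMap.apply ℝ V x)
  have hpara : IsRightPara G := fun q x => by
    rw [Bop, sub_apply, map_sub, sub_eq_zero]
    refine (((hsum x).mapL (rmo q)).mapL (reO V)).unique ?_
    simp only [((hpa _).odotL _).reO_rmo]
    exact (hsum (rmo q x)).mapL (reO V)
  have h (x : V) : reO V (G (X x)) = reO V x := by
    refine hasSum_eq_of_telescoping
      (a := fun n => reO V (rmo (opow (oinv s) n) ((T ^ n) x)))
      ((hsum (X x)).mapL (reO V)) (fun n => ?_) (congrArg (reO V) (rmo_one x)) ?_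
    · have h₁ : reO V (rmo (invPow s n) ((T ^ n) (rmo s x))) =
          reO V (rmo (opow (oinv s) n) ((T ^ n) x)) := by
        rw [(hpa n).reO_rmo, rmo_rmo_of_mem_realSpan (self_mem_realSpan s)
          (invPow_mem_realSpan s n), mul_invPow hs₀, (hpa n).reO_rmo]
      have h₂ : (T ^ n) (T x) = (T ^ (n + 1)) x := by
        rw [pow_succ]
        rfl
      rw [(hpa n).reO_odotL, hX, sub_apply, map_sub, map_sub, map_sub, h₁, h₂, invPow]
    · have h₀ := ((reO V).continuous.tendsto 0).comp (tendsto_rmo_opow_pow hs x)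
      rwa [map_zero] at h₀
  have h' : (reO V).comp (Ring.inverse X) = (reO V).comp G := by
    ext x
    rw [ContinuousLinearMap.comp_apply, ← h]
    change reO V (G ((X * Ring.inverse X) x)) = _
    rw [Ring.mul_inverse_cancel X (isUnit_rmo_sub hs)]
    rfl
  rw [rinvL, h', hpara.lifO_reO_comp]

end Bimodule

/-- Let `V` be a Banach `𝕆`-bimodule, `T` a power-associative bounded right
para-linear operator on `V`, and `s ∈ 𝕆` with `|s| > ‖T‖`.  Then `R_s − T` is invertible
among bounded real-linear operators on `V`, and its regular inverses are given by the
norm-convergent series `(R_s − T)^{⊚−} = ∑_{n≥0} Tⁿ ⊙ s^{−1−n}` and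
`(R_s − T)^{−⊚} = ∑_{n≥0} s^{−1−n} ⊙ Tⁿ`. -/
theorem statement_1 {V : Type*} [NormedAddCommGroup V] [NormedSpace ℝ V] [CompleteSpace V]
    [OctBimodule V] (T : V →L[ℝ] V) (hT : IsRightPara T) (hpa : IsPowerAssoc T)
    (s : Oct) (hs : ‖T‖ < ‖s‖) :
    IsUnit ((rmo s : V →L[ℝ] V) - T) ∧
    Summable (fun n : ℕ => odotR (T ^ n) (Oct.invPow s n)) ∧
    Summable (fun n : ℕ => odotL (Oct.invPow s n) (T ^ n)) ∧
    rinvR ((rmo s : V →L[ℝ] V) - T) = ∑' n : ℕ, odotR (T ^ n) (Oct.invPow s n) ∧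
    rinvL ((rmo s : V →L[ℝ] V) - T) = ∑' n : ℕ, odotL (Oct.invPow s n) (T ^ n) := by
  exact ⟨isUnit_rmo_sub hs, summable_odotR hs, summable_odotL hs, rinvR_rmo_sub hpa hs,
    rinvL_rmo_sub hpa hs⟩
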